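/- arXiv:2302.09672 — 8 statements merged into one kernel-verified Lean document; each statement's English description precedes it below -/
import Mathlib

section
/- Let n ≥ 2 be an integer and let d₁, d₂ be positive integers with d₁ + d₂ < n + 1. Then the polytope P(n,d₁,d₂) ⊆ ℝ² equals the convex hull of the four points (0,0), ((n+1)(d₁-1)/(n d₁), 0), (0, (n+1)(d₂-1)/(n d₂)), and ((d₂-1+n(d₁-1))/((n-1)d₁), (d₁-1+n(d₂-1))/((n-1)d₂)). (This is the combinatorial content of the computation of the K-semistable domain Kss(ℙⁿ, S_{d₁}+S_{d₂}) for two general smooth hypersurfaces of degrees d₁, d₂.) -/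
/-- A convex set containing the origin is closed under subconvex combinations of two points. -/
theorem Convex.add_smul_mem_of_zero_mem {E : Type*} [AddCommGroup E] [Module ℝ E] {s : Set E}
    (hs : Convex ℝ s) (h0 : (0 : E) ∈ s) {x y : E} (hx : x ∈ s) (hy : y ∈ s) {α β : ℝ}
    (hα : 0 ≤ α) (hβ : 0 ≤ β) (h : α + β ≤ 1) : α • x + β • y ∈ s := by
  have key := hs.sum_mem (t := Finset.univ) (w := ![1 - α - β, α, β]) (z := ![0, x, y])
    (by intro i _; fin_cases i <;> simp <;> linarith)
    (by simp only [Fin.sum_univ_three, Matrix.cons_val]; ring)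
    (by intro i _; fin_cases i <;> simpa)
  simpa [Fin.sum_univ_three] using key

/-- The part of the quadrilateral below its diagonal through the origin is the triangle spanned
by the origin, the vertex on the first axis and the opposite vertex. -/
theorem exists_weights_of_below_diagonal {n a b u v : ℝ} (hn : 1 < n) (ha : 0 ≤ a) (hb : 0 ≤ b)
    (hu : 0 ≤ u) (hv : 0 ≤ v) (h₁ : n * u - v ≤ (n + 1) * a) (h₂ : n * v - u ≤ (n + 1) * b)
    (hdiag : v * (b + n * a) ≤ u * (a + n * b)) :
    ∃ α β : ℝ, 0 ≤ α ∧ 0 ≤ β ∧ α + β ≤ 1 ∧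
      u = α * ((n + 1) * a / n) + β * ((b + n * a) / (n - 1)) ∧
      v = β * ((a + n * b) / (n - 1)) := by
  have hn0 : 0 < n := by linarith
  have hn1 : 0 < n - 1 := by linarith
  rcases ha.eq_or_lt with rfl | ha
  · rcases hb.eq_or_lt with rfl | hb
    · have hu0 : u = 0 := by nlinarith
      have hv0 : v = 0 := by nlinarith
      exact ⟨0, 0, by simp [hu0, hv0]⟩
    · have hvu : v = n * u := by
        have : v ≤ n * u := le_of_mul_le_mul_right (by linarith) hb
        linarith
      subst hvu
      have hub : u * (n - 1) ≤ b :=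
        le_of_mul_le_mul_left (by linarith) (by linarith : (0 : ℝ) < n + 1)
      refine ⟨0, u * (n - 1) / b, le_rfl, by positivity, ?_, ?_, ?_⟩
      · rw [zero_add, div_le_one hb]
        exact hub
      · field_simp
        ring
      · field_simp
        ring
  · have hV : 0 < a + n * b := by positivity
    refine ⟨n * (u * (a + n * b) - v * (b + n * a)) / ((n + 1) * a * (a + n * b)),
      v * (n - 1) / (a + n * b), ?_, by positivity, ?_, ?_, ?_⟩
    · have := sub_nonneg.2 hdiag
      positivity
    · have : n * (u * (a + n * b) - v * (b + n * a)) / ((n + 1) * a * (a + n * b)) +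
          v * (n - 1) / (a + n * b) = (n * u - v) / ((n + 1) * a) := by
        field_simp
        ring
      rw [this, div_le_one (by positivity)]
      exact h₁
    · field_simp
      ring
    · field_simp

/-- The K-semistable domain `Kss(ℙⁿ, S_{d₁}+S_{d₂})` in the case `d₁ + d₂ < n + 1`:
the polytope `P(n,d₁,d₂)` equals the convex hull of four explicit points. -/
theorem kss_domain_Pn_two_divisors_lt (n d₁ d₂ : ℕ) (hn : 2 ≤ n)
    (hd₁ : 0 < d₁) (hd₂ : 0 < d₂) (hsum : d₁ + d₂ < n + 1) :
    {p : ℝ × ℝ | 0 ≤ p.1 ∧ p.1 ≤ 1 ∧ 0 ≤ p.2 ∧ p.2 ≤ 1 ∧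
      (d₁ : ℝ) * p.1 + (d₂ : ℝ) * p.2 ≤ (n : ℝ) + 1 ∧
      0 ≤ ((d₁ : ℝ) - 1) / (d₁ : ℝ) - (n : ℝ) * p.1 / ((n : ℝ) + 1)
          + (d₂ : ℝ) * p.2 / ((d₁ : ℝ) * ((n : ℝ) + 1)) ∧
      0 ≤ ((d₂ : ℝ) - 1) / (d₂ : ℝ) - (n : ℝ) * p.2 / ((n : ℝ) + 1)
          + (d₁ : ℝ) * p.1 / ((d₂ : ℝ) * ((n : ℝ) + 1))} =
    convexHull ℝ
      {((0 : ℝ), (0 : ℝ)),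
       ((((n : ℝ) + 1) * ((d₁ : ℝ) - 1)) / ((n : ℝ) * (d₁ : ℝ)), 0),
       (0, (((n : ℝ) + 1) * ((d₂ : ℝ) - 1)) / ((n : ℝ) * (d₂ : ℝ))),
       ((((d₂ : ℝ) - 1 + (n : ℝ) * ((d₁ : ℝ) - 1)) / (((n : ℝ) - 1) * (d₁ : ℝ))),
        (((d₁ : ℝ) - 1 + (n : ℝ) * ((d₂ : ℝ) - 1)) / (((n : ℝ) - 1) * (d₂ : ℝ))))} := by
  have hn' : (2 : ℝ) ≤ n := by exact_mod_cast hn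
  have h₁ : (1 : ℝ) ≤ d₁ := by exact_mod_cast hd₁
  have h₂ : (1 : ℝ) ≤ d₂ := by exact_mod_cast hd₂
  have hs : (d₁ : ℝ) + d₂ ≤ n := by exact_mod_cast Nat.lt_succ_iff.1 hsum
  generalize (n : ℝ) = N at *
  generalize (d₁ : ℝ) = D at *
  generalize (d₂ : ℝ) = E at *
  have hN1 : 0 < N - 1 := by linarith
  have hN0 : 0 < N := by linarith
  have hD : 0 < D := by linarith
  have hE : 0 < E := by linarith
  have ha : 0 ≤ D - 1 := by linarith
  have hb : 0 ≤ E - 1 := by linarith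
  have facet (D E x y : ℝ) (hD : 0 < D) :
      0 ≤ (D - 1) / D - N * x / (N + 1) + E * y / (D * (N + 1)) ↔
        N * (D * x) - E * y ≤ (N + 1) * (D - 1) := by
    have : (D - 1) / D - N * x / (N + 1) + E * y / (D * (N + 1)) =
        ((N + 1) * (D - 1) - (N * (D * x) - E * y)) / (D * (N + 1)) := by
      field_simp
      ring
    rw [this, le_div_iff₀ (by positivity), zero_mul, sub_nonneg]
  simp only [facet D E _ _ hD, facet E D _ _ hE]
  apply Set.Subset.antisymm
  · rintro ⟨x, y⟩ ⟨hx, -, hy, -, -, hf₁, hf₂⟩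
    dsimp only at hx hy hf₁ hf₂
    set S : Set (ℝ × ℝ) := _
    change (x, y) ∈ convexHull ℝ S
    have h0 : (0 : ℝ × ℝ) ∈ convexHull ℝ S := subset_convexHull ℝ S (Or.inl rfl)
    have hu : 0 ≤ D * x := by positivity
    have hv : 0 ≤ E * y := by positivity
    have hV := subset_convexHull ℝ S (Or.inr (Or.inr (Or.inr rfl)))
    rcases le_total (E * y * (E - 1 + N * (D - 1))) (D * x * (D - 1 + N * (E - 1))) with h | h
    · obtain ⟨α, β, hα, hβ, hαβ, hxe, hye⟩ :=
        exists_weights_of_below_diagonal (by linarith) ha hb hu hv hf₁ hf₂ h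
      convert (convex_convexHull ℝ S).add_smul_mem_of_zero_mem h0
        (subset_convexHull ℝ S (Or.inr (Or.inl rfl))) hV hα hβ hαβ using 1
      ext
      · apply mul_left_cancel₀ hD.ne'
        simp only [Prod.fst_add, Prod.smul_fst, smul_eq_mul]
        rw [hxe]
        field_simp
      · apply mul_left_cancel₀ hE.ne'
        simp only [Prod.snd_add, Prod.smul_snd, smul_eq_mul]
        rw [hye]
        field_simp
        ring
    · obtain ⟨α, β, hα, hβ, hαβ, hye, hxe⟩ :=
        exists_weights_of_below_diagonal (by linarith) hb ha hv hu hf₂ hf₁ h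
      convert (convex_convexHull ℝ S).add_smul_mem_of_zero_mem h0
        (subset_convexHull ℝ S (Or.inr (Or.inr (Or.inl rfl)))) hV hα hβ hαβ using 1
      ext
      · apply mul_left_cancel₀ hD.ne'
        simp only [Prod.fst_add, Prod.smul_fst, smul_eq_mul]
        rw [hxe]
        field_simp
        ring
      · apply mul_left_cancel₀ hE.ne'
        simp only [Prod.snd_add, Prod.smul_snd, smul_eq_mul]
        rw [hye]
        field_simp
  · apply convexHull_min
    · have hDN : (N + 1) * (D - 1) / (N * D) ≤ 1 := by
        rw [div_le_one (by positivity)]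
        linarith
      have hEN : (N + 1) * (E - 1) / (N * E) ≤ 1 := by
        rw [div_le_one (by positivity)]
        linarith
      have hab : 0 ≤ (N + 1) * (D - 1) := by positivity
      have hba : 0 ≤ (N + 1) * (E - 1) := by positivity
      have eD : D * ((N + 1) * (D - 1) / (N * D)) = (N + 1) * (D - 1) / N := by field_simp
      have eE : E * ((N + 1) * (E - 1) / (N * E)) = (N + 1) * (E - 1) / N := by field_simp
      have eD' : D * ((E - 1 + N * (D - 1)) / ((N - 1) * D)) =
          (E - 1 + N * (D - 1)) / (N - 1) := by field_simp
      have eE' : E * ((D - 1 + N * (E - 1)) / ((N - 1) * E)) =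
          (D - 1 + N * (E - 1)) / (N - 1) := by field_simp
      rintro p (rfl | rfl | rfl | rfl) <;> simp only [Set.mem_ofPred_eq]
      · refine ⟨le_rfl, zero_le_one, le_rfl, zero_le_one, ?_, ?_, ?_⟩ <;> linarith
      · rw [eD]
        refine ⟨by positivity, hDN, le_rfl, zero_le_one, ?_, ?_, ?_⟩
        · rw [mul_zero, add_zero, div_le_iff₀ hN0]
          nlinarith
        · rw [mul_div_cancel₀ _ hN0.ne']
          linarith
        · have : 0 ≤ (N + 1) * (D - 1) / N := by positivity
          linarith
      · rw [eE]
        refine ⟨le_rfl, zero_le_one, by positivity, hEN, ?_, ?_, ?_⟩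
        · rw [mul_zero, zero_add, div_le_iff₀ hN0]
          nlinarith
        · have : 0 ≤ (N + 1) * (E - 1) / N := by positivity
          linarith
        · rw [mul_div_cancel₀ _ hN0.ne']
          linarith
      · rw [eD', eE']
        refine ⟨by positivity, ?_, by positivity, ?_, ?_, ?_, ?_⟩
        · rw [div_le_one (by positivity)]
          linarith
        · rw [div_le_one (by positivity)]
          linarith
        · rw [← add_div, div_le_iff₀ hN1]
          nlinarith
        · apply le_of_eq
          field_simp
          ring
        · apply le_of_eq
          field_simp
          ring
    · rintro ⟨x, y⟩ ⟨hx, hx', hy, hy', h, hf₁, hf₂⟩ ⟨z, w⟩ ⟨hz, hz', hw, hw', k, hk₁, hk₂⟩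
        s t hs0 ht0 hst
      dsimp only at *
      obtain rfl : t = 1 - s := by linarith
      simp only [Set.mem_ofPred_eq, Prod.smul_mk, Prod.mk_add_mk, smul_eq_mul]
      refine ⟨by positivity, ?_, by positivity, ?_, ?_, ?_, ?_⟩
      · linarith [mul_le_mul_of_nonneg_left hx' hs0, mul_le_mul_of_nonneg_left hz' ht0]
      · linarith [mul_le_mul_of_nonneg_left hy' hs0, mul_le_mul_of_nonneg_left hw' ht0]
      · linarith [mul_le_mul_of_nonneg_left h hs0, mul_le_mul_of_nonneg_left k ht0]
      · linarith [mul_le_mul_of_nonneg_left hf₁ hs0, mul_le_mul_of_nonneg_left hk₁ ht0]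
      · linarith [mul_le_mul_of_nonneg_left hf₂ hs0, mul_le_mul_of_nonneg_left hk₂ ht0]
end

section
/- Let n ≥ 2 be an integer and let d₁, d₂ be positive integers with d₁ ≤ n+1, d₂ ≤ n+1 and d₁ + d₂ ≥ n + 1. Then the polytope P(n,d₁,d₂) ⊆ ℝ² equals the convex hull of the five points (0,0), ((n+1)(d₁-1)/(n d₁), 0), (0, (n+1)(d₂-1)/(n d₂)), (1, (n+1-d₁)/d₂), and ((n+1-d₂)/d₁, 1). (This is the combinatorial content of the computation of the K-semistable domain Kss(ℙⁿ, S_{d₁}+S_{d₂}) for two general smooth hypersurfaces of degrees d₁, d₂.) -/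
theorem Convex.smul_add_smul_mem_of_zero_mem {E : Type*} [AddCommGroup E] [Module ℝ E]
    {s : Set E} (hs : Convex ℝ s) (h0 : (0 : E) ∈ s) {p q : E} (hp : p ∈ s) (hq : q ∈ s)
    {α β : ℝ} (hα : 0 ≤ α) (hβ : 0 ≤ β) (hαβ : α + β ≤ 1) : α • p + β • q ∈ s := by
  rcases (add_nonneg hα hβ).eq_or_lt with h | h
  · obtain rfl : α = 0 := by linarith
    obtain rfl : β = 0 := by linarith
    simpa using h0
  · have hmem : (α / (α + β)) • p + (β / (α + β)) • q ∈ s :=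
      hs hp hq (by positivity) (by positivity) (by field_simp)
    convert hs.smul_mem_of_zero_mem h0 hmem ⟨h.le, hαβ⟩ using 1
    rw [smul_add, smul_smul, smul_smul, mul_div_cancel₀ _ h.ne', mul_div_cancel₀ _ h.ne']

/-- The facet inequality with its denominators cleared. -/
theorem facet_nonneg_iff {n a b x y : ℝ} (hn : 0 < n) (ha : 0 < a) :
    0 ≤ (a - 1) / a - n * x / (n + 1) + b * y / (a * (n + 1)) ↔
      n * (a * x) ≤ (n + 1) * (a - 1) + b * y := by
  have h : (a - 1) / a - n * x / (n + 1) + b * y / (a * (n + 1)) =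
      ((n + 1) * (a - 1) + b * y - n * (a * x)) / (a * (n + 1)) := by
    field_simp
    ring
  rw [h, le_div_iff₀ (by positivity), zero_mul, sub_nonneg]

/-- Coordinates of a point in the triangle with vertices the origin, the vertex on the first
axis, and the vertex with first coordinate `1`. -/
theorem exists_coords_axis_triangle {n a b x y : ℝ} (hn : 0 < n) (ha : 1 ≤ a) (han : a ≤ n + 1)
    (hb : 0 < b) (hx : 0 ≤ x) (hx1 : x ≤ 1) (hy : 0 ≤ y) (hxy : b * y ≤ x * (n + 1 - a))
    (hfacet : n * (a * x) ≤ (n + 1) * (a - 1) + b * y) :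
    ∃ α β : ℝ, 0 ≤ α ∧ 0 ≤ β ∧ α + β ≤ 1 ∧
      x = α * ((n + 1) * (a - 1) / (n * a)) + β ∧ y = β * ((n + 1 - a) / b) := by
  rcases han.eq_or_lt with rfl | han
  · have hy0 : y = 0 := by
      have : b * y ≤ 0 := by linarith
      nlinarith
    exact ⟨0, x, le_rfl, hx, by linarith, by ring, by simp [hy0]⟩
  rcases ha.eq_or_lt with rfl | ha
  · have h : b * y = x * n := by linarith
    refine ⟨0, x, le_rfl, hx, by linarith, by ring, ?_⟩
    field_simp
    linarith
  have h1 : 0 < a - 1 := by linarith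
  have h2 : 0 < n + 1 - a := by linarith
  have ha0 : 0 < a := by linarith
  refine ⟨n * a * (x * (n + 1 - a) - b * y) / ((n + 1) * (a - 1) * (n + 1 - a)),
    b * y / (n + 1 - a), ?_, by positivity, ?_, ?_, ?_⟩
  · have := sub_nonneg.2 hxy
    positivity
  · have h : n * a * (x * (n + 1 - a) - b * y) / ((n + 1) * (a - 1) * (n + 1 - a)) +
        b * y / (n + 1 - a) = (n * (a * x) - b * y) / ((n + 1) * (a - 1)) := by
      field_simp
      ring
    rw [h, div_le_one (by positivity)]
    linarith
  · field_simp
    ring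
  · field_simp

/-- Coordinates of a point in the triangle with vertices the origin and the two vertices on the
line `a * x + b * y = n + 1`. -/
theorem exists_coords_middle_triangle {n a b x y : ℝ} (hn : 0 < n) (ha : 0 < a) (hb : 0 < b)
    (hab : n + 1 ≤ a + b) (hx : 0 ≤ x) (hsum : a * x + b * y ≤ n + 1)
    (hxy : x * (n + 1 - a) ≤ b * y) (hyx : y * (n + 1 - b) ≤ a * x) :
    ∃ α β : ℝ, 0 ≤ α ∧ 0 ≤ β ∧ α + β ≤ 1 ∧
      x = α + β * ((n + 1 - b) / a) ∧ y = α * ((n + 1 - a) / b) + β := by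
  rcases hab.eq_or_lt with hab | hab
  · have h1 : n + 1 - a = b := by linarith
    have h2 : n + 1 - b = a := by linarith
    rw [h1] at hxy
    rw [h2] at hyx
    have hyx' : y = x := le_antisymm (by nlinarith) (by nlinarith)
    subst hyx'
    refine ⟨y, 0, hx, le_rfl, ?_, by ring, ?_⟩
    · nlinarith
    · rw [h1, div_self hb.ne']
      ring
  have hd : 0 < a + b - (n + 1) := by linarith
  refine ⟨b * (a * x - y * (n + 1 - b)) / ((n + 1) * (a + b - (n + 1))),
    a * (b * y - x * (n + 1 - a)) / ((n + 1) * (a + b - (n + 1))), ?_, ?_, ?_, ?_, ?_⟩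
  · have := sub_nonneg.2 hyx
    positivity
  · have := sub_nonneg.2 hxy
    positivity
  · have h : b * (a * x - y * (n + 1 - b)) / ((n + 1) * (a + b - (n + 1))) +
        a * (b * y - x * (n + 1 - a)) / ((n + 1) * (a + b - (n + 1))) =
        (a * x + b * y) / (n + 1) := by
      field_simp
      ring
    rw [h, div_le_one (by positivity)]
    exact hsum
  · field_simp
    ring
  · field_simp
    ring

/-- The K-semistable domain `Kss(ℙⁿ, S_{d₁}+S_{d₂})` in the case `d₁ + d₂ ≥ n + 1`:
the polytope `P(n,d₁,d₂)` equals the convex hull of five explicit points. -/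
theorem kss_domain_Pn_two_divisors_ge (n d₁ d₂ : ℕ) (hn : 2 ≤ n)
    (hd₁ : 0 < d₁) (hd₂ : 0 < d₂) (hd₁' : d₁ ≤ n + 1) (hd₂' : d₂ ≤ n + 1)
    (hsum : n + 1 ≤ d₁ + d₂) :
    {p : ℝ × ℝ | 0 ≤ p.1 ∧ p.1 ≤ 1 ∧ 0 ≤ p.2 ∧ p.2 ≤ 1 ∧
      (d₁ : ℝ) * p.1 + (d₂ : ℝ) * p.2 ≤ (n : ℝ) + 1 ∧
      0 ≤ ((d₁ : ℝ) - 1) / (d₁ : ℝ) - (n : ℝ) * p.1 / ((n : ℝ) + 1)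
          + (d₂ : ℝ) * p.2 / ((d₁ : ℝ) * ((n : ℝ) + 1)) ∧
      0 ≤ ((d₂ : ℝ) - 1) / (d₂ : ℝ) - (n : ℝ) * p.2 / ((n : ℝ) + 1)
          + (d₁ : ℝ) * p.1 / ((d₂ : ℝ) * ((n : ℝ) + 1))} =
    convexHull ℝ
      {((0 : ℝ), (0 : ℝ)),
       ((((n : ℝ) + 1) * ((d₁ : ℝ) - 1)) / ((n : ℝ) * (d₁ : ℝ)), 0),
       (0, (((n : ℝ) + 1) * ((d₂ : ℝ) - 1)) / ((n : ℝ) * (d₂ : ℝ))),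
       (1, ((n : ℝ) + 1 - (d₁ : ℝ)) / (d₂ : ℝ)),
       (((n : ℝ) + 1 - (d₂ : ℝ)) / (d₁ : ℝ), 1)} := by
  have hn0 : (0 : ℝ) < n := by exact_mod_cast (by omega : 0 < n)
  have ha : (1 : ℝ) ≤ d₁ := by exact_mod_cast hd₁
  have hb : (1 : ℝ) ≤ d₂ := by exact_mod_cast hd₂
  have han : (d₁ : ℝ) ≤ n + 1 := by exact_mod_cast hd₁'
  have hbn : (d₂ : ℝ) ≤ n + 1 := by exact_mod_cast hd₂'
  have hab : (n : ℝ) + 1 ≤ d₁ + d₂ := by exact_mod_cast hsum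
  generalize (n : ℝ) = n, (d₁ : ℝ) = a, (d₂ : ℝ) = b at *
  have ha0 : 0 < a := by linarith
  have hb0 : 0 < b := by linarith
  simp only [facet_nonneg_iff hn0 ha0, facet_nonneg_iff hn0 hb0]
  apply Set.Subset.antisymm
  · rintro ⟨x, y⟩ ⟨hx, hx1, hy, hy1, hline, h₁, h₂⟩
    dsimp only at hx hx1 hy hy1 hline h₁ h₂
    have mem {α β : ℝ} {p q : ℝ × ℝ} := (convex_convexHull ℝ
      {((0 : ℝ), (0 : ℝ)), ((n + 1) * (a - 1) / (n * a), 0), (0, (n + 1) * (b - 1) / (n * b)),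
        (1, (n + 1 - a) / b), ((n + 1 - b) / a, 1)}).smul_add_smul_mem_of_zero_mem
      (subset_convexHull ℝ _ (Or.inl rfl)) (p := p) (q := q) (α := α) (β := β)
    rcases le_total (b * y) (x * (n + 1 - a)) with hxy | hxy
    · obtain ⟨α, β, hα, hβ, hαβ, ex, ey⟩ :=
        exists_coords_axis_triangle hn0 ha han hb0 hx hx1 hy hxy h₁
      convert mem (p := ((n + 1) * (a - 1) / (n * a), 0)) (q := (1, (n + 1 - a) / b))
        (subset_convexHull ℝ _ (by simp)) (subset_convexHull ℝ _ (by simp)) hα hβ hαβ using 1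
      simp [← ex, ← ey]
    rcases le_total (a * x) (y * (n + 1 - b)) with hyx | hyx
    · obtain ⟨α, β, hα, hβ, hαβ, ey, ex⟩ :=
        exists_coords_axis_triangle hn0 hb hbn ha0 hy hy1 hx hyx h₂
      convert mem (p := (0, (n + 1) * (b - 1) / (n * b))) (q := ((n + 1 - b) / a, 1))
        (subset_convexHull ℝ _ (by simp)) (subset_convexHull ℝ _ (by simp)) hα hβ hαβ using 1
      simp [← ex, ← ey]
    · obtain ⟨α, β, hα, hβ, hαβ, ex, ey⟩ :=
        exists_coords_middle_triangle hn0 ha0 hb0 hab hx hline hxy hyx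
      convert mem (p := (1, (n + 1 - a) / b)) (q := ((n + 1 - b) / a, 1))
        (subset_convexHull ℝ _ (by simp)) (subset_convexHull ℝ _ (by simp)) hα hβ hαβ using 1
      simp [← ex, ← ey]
  · apply convexHull_min
    · have axis_vertex {a b : ℝ} (ha : 1 ≤ a) (han : a ≤ n + 1) (hb : 1 ≤ b) :
          0 ≤ (n + 1) * (a - 1) / (n * a) ∧ (n + 1) * (a - 1) / (n * a) ≤ 1 ∧
          a * ((n + 1) * (a - 1) / (n * a)) ≤ n + 1 ∧
          n * (a * ((n + 1) * (a - 1) / (n * a))) ≤ (n + 1) * (a - 1) ∧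
          0 ≤ (n + 1) * (b - 1) + a * ((n + 1) * (a - 1) / (n * a)) := by
        have ha0 : 0 < a := by linarith
        have h1 : 0 ≤ a - 1 := by linarith
        have h2 : 0 ≤ b - 1 := by linarith
        have e : n * (a * ((n + 1) * (a - 1) / (n * a))) = (n + 1) * (a - 1) := by field_simp
        refine ⟨by positivity, ?_, ?_, e.le, by positivity⟩
        · rw [div_le_one (by positivity)]
          linarith
        · refine le_of_mul_le_mul_left ?_ hn0
          rw [e]
          nlinarith
      have unit_vertex {a b : ℝ} (ha : 1 ≤ a) (han : a ≤ n + 1) (hb : 1 ≤ b)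
          (hab : n + 1 ≤ a + b) :
          0 ≤ (n + 1 - a) / b ∧ (n + 1 - a) / b ≤ 1 ∧ b * ((n + 1 - a) / b) = n + 1 - a := by
        have hb0 : 0 < b := by linarith
        refine ⟨div_nonneg (by linarith) hb0.le, ?_, mul_div_cancel₀ _ hb0.ne'⟩
        rw [div_le_one hb0]
        linarith
      obtain ⟨A1, A2, A3, A4, A5⟩ := axis_vertex ha han hb
      obtain ⟨B1, B2, B3, B4, B5⟩ := axis_vertex hb hbn ha
      obtain ⟨C1, C2, C3⟩ := unit_vertex ha han hb hab
      obtain ⟨D1, D2, D3⟩ := unit_vertex hb hbn ha (by linarith)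
      have ha1 : 0 ≤ (n + 1) * (a - 1) := mul_nonneg (by linarith) (by linarith)
      have hb1 : 0 ≤ (n + 1) * (b - 1) := mul_nonneg (by linarith) (by linarith)
      have hab1 : 0 ≤ (n + 1) * (a + b - (n + 1)) := mul_nonneg (by linarith) (by linarith)
      rintro p (rfl | rfl | rfl | rfl | rfl) <;>
        refine ⟨?_, ?_, ?_, ?_, ?_, ?_, ?_⟩ <;> dsimp only <;>
        try simp only [C3, D3]
      all_goals linarith
    · rintro ⟨x, y⟩ ⟨h1, h2, h3, h4, h5, h6, h7⟩ ⟨x', y'⟩ ⟨k1, k2, k3, k4, k5, k6, k7⟩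
        s t hs ht hst
      obtain rfl : t = 1 - s := by linarith
      dsimp only at *
      refine ⟨?_, ?_, ?_, ?_, ?_, ?_, ?_⟩ <;>
        simp only [Prod.smul_mk, Prod.mk_add_mk, smul_eq_mul]
      · positivity
      · nlinarith
      · positivity
      · nlinarith
      · nlinarith
      · nlinarith
      · nlinarith
end

section
/- Let n ≥ 2 be an integer and let d, d₁, d₂ be positive integers with d₁ + d₂ < n + 2 - d. Then the polytope Q(n,d,d₁,d₂) ⊆ ℝ² equals the convex hull of the four points (0,0), (((n+1)d₁-(n+2-d))/(n d₁), 0), (0, ((n+1)d₂-(n+2-d))/(n d₂)), and ((d₂+n d₁-(n+2-d))/((n-1)d₁), (d₁+n d₂-(n+2-d))/((n-1)d₂)). (This is the combinatorial content of the computation of the K-semistable domain Kss(S_d, S_{d₁}|_{S_d}+S_{d₂}|_{S_d}) for general smooth hypersurfaces of degrees d, d₁, d₂ in ℙ^{n+1}.) -/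
/-- In the quadrilateral with vertices `(0,0)`, `(A/n,0)`, `(p,q)`, `(0,B/n)`, each point on the
side of the diagonal through `(p,q)` containing `(A/n,0)` lies in the triangle
`(0,0)`, `(A/n,0)`, `(p,q)`. -/
lemma exists_triangle_coords {n A B p q u v : ℝ} (hn : 1 < n) (hA : 0 ≤ A) (hB : 0 ≤ B)
    (hp : 0 ≤ p) (hq : 0 ≤ q) (hpA : n * p = q + A) (hqB : n * q = p + B)
    (hu : 0 ≤ u) (hv : 0 ≤ v) (huA : n * u ≤ v + A) (hvB : n * v ≤ u + B)
    (hside : p * v ≤ q * u) :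
    ∃ s t : ℝ, 0 ≤ s ∧ 0 ≤ t ∧ s + t ≤ 1 ∧ u = s * (A / n) + t * p ∧ v = t * q := by
  have hn0 : 0 < n := by linarith
  rcases hq.eq_or_lt with rfl | hq'
  · have hp0 : p = 0 := by linarith
    subst hp0
    have hA0 : A = 0 := by linarith
    have hB0 : B = 0 := by linarith
    subst hA0 hB0
    have huv : u + v ≤ 0 := by nlinarith
    exact ⟨0, 0, le_rfl, le_rfl, by norm_num, by linarith, by linarith⟩
  rcases hA.eq_or_lt with rfl | hA'
  · have hp' : 0 < p := by nlinarith
    have hvq : n * u = v := by nlinarith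
    refine ⟨0, v / q, le_rfl, by positivity, ?_, ?_, by field_simp⟩
    · rw [zero_add, div_le_one hq']
      have : (n ^ 2 - 1) * v ≤ (n ^ 2 - 1) * q := by nlinarith
      exact le_of_mul_le_mul_left this (by nlinarith)
    · have : q = n * p := by linarith
      rw [← hvq, this]
      field_simp
      ring
  · refine ⟨n * (q * u - p * v) / (q * A), v / q, ?_, by positivity, ?_, ?_, by field_simp⟩
    · have : 0 ≤ q * u - p * v := by linarith
      positivity
    · have : n * (q * u - p * v) / (q * A) + v / q = (n * (q * u - p * v) + v * A) / (q * A) := by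
        field_simp
      rw [this, div_le_one (by positivity)]
      linear_combination q * huA - v * hpA
    · field_simp
      ring

/-- A point of a triangle with one vertex at the origin belongs to the convex hull of any set
containing the vertices. -/
lemma smul_add_smul_mem_convexHull {E : Type*} [AddCommGroup E] [Module ℝ E] {S : Set E} {a b : E}
    {s t : ℝ} (h0 : (0 : E) ∈ S) (ha : a ∈ S) (hb : b ∈ S) (hs : 0 ≤ s) (ht : 0 ≤ t)
    (hst : s + t ≤ 1) : s • a + t • b ∈ convexHull ℝ S := by
  have h := (convex_convexHull ℝ S).sum_mem (t := Finset.univ) (w := ![s, t, 1 - s - t])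
    (z := ![a, b, 0]) (by intro i _; fin_cases i <;> simp <;> linarith)
    (by simp [Fin.sum_univ_three])
    (by intro i _; fin_cases i <;> simp <;> apply subset_convexHull <;> assumption)
  simpa [Fin.sum_univ_three] using h

/-- The region cut out of the positive quadrant by two half-planes `n * a * x ≤ b * y + A` and
`n * b * y ≤ a * x + B` is the convex hull of its vertices. -/
lemma quadrilateral_eq_convexHull {n a b A B p q : ℝ} (hn : 1 < n) (ha : 0 < a) (hb : 0 < b)
    (hA : 0 ≤ A) (hB : 0 ≤ B) (hp : 0 ≤ p) (hq : 0 ≤ q)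
    (hpA : n * p = q + A) (hqB : n * q = p + B) :
    {z : ℝ × ℝ | 0 ≤ z.1 ∧ 0 ≤ z.2 ∧ n * (a * z.1) ≤ b * z.2 + A ∧ n * (b * z.2) ≤ a * z.1 + B} =
      convexHull ℝ {((0 : ℝ), (0 : ℝ)), (A / (n * a), 0), (0, B / (n * b)), (p / a, q / b)} := by
  have hn0 : 0 < n := by linarith
  apply Set.Subset.antisymm
  · rintro ⟨x, y⟩ ⟨hx, hy, h1, h2⟩
    dsimp only at hx hy h1 h2
    have hu : 0 ≤ a * x := by positivity
    have hv : 0 ≤ b * y := by positivity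
    rcases le_total (p * (b * y)) (q * (a * x)) with h | h
    · obtain ⟨s, t, hs, ht, hst, e1, e2⟩ :=
        exists_triangle_coords hn hA hB hp hq hpA hqB hu hv h1 h2 h
      have e : (x, y) = s • (A / (n * a), (0 : ℝ)) + t • (p / a, q / b) := by
        ext
        · simp only [Prod.fst_add, Prod.smul_fst, smul_eq_mul]
          apply mul_left_cancel₀ ha.ne'
          rw [e1]
          field_simp
        · simp only [Prod.snd_add, Prod.smul_snd, smul_eq_mul]
          apply mul_left_cancel₀ hb.ne'
          rw [e2]
          field_simp
          ring
      rw [e]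
      exact smul_add_smul_mem_convexHull (.inl rfl) (by simp) (by simp) hs ht hst
    · obtain ⟨s, t, hs, ht, hst, e1, e2⟩ :=
        exists_triangle_coords hn hB hA hq hp hqB hpA hv hu h2 h1 h
      have e : (x, y) = s • ((0 : ℝ), B / (n * b)) + t • (p / a, q / b) := by
        ext
        · simp only [Prod.fst_add, Prod.smul_fst, smul_eq_mul]
          apply mul_left_cancel₀ ha.ne'
          rw [e2]
          field_simp
          ring
        · simp only [Prod.snd_add, Prod.smul_snd, smul_eq_mul]
          apply mul_left_cancel₀ hb.ne'
          rw [e1]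
          field_simp
      rw [e]
      exact smul_add_smul_mem_convexHull (.inl rfl) (by simp) (by simp) hs ht hst
  · apply convexHull_min
    · have e1 : n * (a * (A / (n * a))) = A := by field_simp
      have e2 : n * (b * (B / (n * b))) = B := by field_simp
      have e3 : a * (p / a) = p := by field_simp
      have e4 : b * (q / b) = q := by field_simp
      have e5 : 0 ≤ a * (A / (n * a)) := by positivity
      have e6 : 0 ≤ b * (B / (n * b)) := by positivity
      rintro z (rfl | rfl | rfl | rfl)
      · simp [hA, hB]
      · refine ⟨by positivity, le_rfl, ?_, ?_⟩ <;> dsimp only <;> linarith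
      · refine ⟨le_rfl, by positivity, ?_, ?_⟩ <;> dsimp only <;> linarith
      · refine ⟨by positivity, by positivity, ?_, ?_⟩ <;> dsimp only <;> rw [e3, e4] <;> linarith
    · rintro ⟨x, y⟩ ⟨h1, h2, h3, h4⟩ ⟨x', y'⟩ ⟨h1', h2', h3', h4'⟩ s t hs ht hst
      dsimp only at h1 h2 h3 h4 h1' h2' h3' h4'
      refine ⟨?_, ?_, ?_, ?_⟩ <;>
        simp only [Prod.smul_mk, Prod.mk_add_mk, smul_eq_mul]
      · positivity
      · positivity
      · linear_combination s * h3 + t * h3' + A * hst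
      · linear_combination s * h4 + t * h4' + B * hst

/-- The half-plane condition of `Q(n,d,d₁,d₂)` with denominators cleared. -/
lemma halfplane_iff {n a b r x y : ℝ} (hn : 0 < n) (ha : 0 < a) :
    0 ≤ (a * (n + 1) - r) / (a * (n + 1)) - n * x / (n + 1) + b * y / (a * (n + 1)) ↔
      n * (a * x) ≤ b * y + ((n + 1) * a - r) := by
  have e : (a * (n + 1) - r) / (a * (n + 1)) - n * x / (n + 1) + b * y / (a * (n + 1)) =
      (b * y + ((n + 1) * a - r) - n * (a * x)) / (a * (n + 1)) := by
    field_simp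
    ring
  rw [e, le_div_iff₀ (by positivity), zero_mul, sub_nonneg]


/-- The K-semistable domain `Kss(S_d, S_{d₁}|_{S_d}+S_{d₂}|_{S_d})` in the case
`d₁ + d₂ < n + 2 - d`: the polytope `Q(n,d,d₁,d₂)` equals the convex hull of four
explicit points. -/
theorem kss_domain_Sd_two_divisors_lt (n d d₁ d₂ : ℕ) (hn : 2 ≤ n)
    (hd : 0 < d) (hd₁ : 0 < d₁) (hd₂ : 0 < d₂) (hsum : d₁ + d₂ + d < n + 2) :
    {p : ℝ × ℝ | 0 ≤ p.1 ∧ p.1 ≤ 1 ∧ 0 ≤ p.2 ∧ p.2 ≤ 1 ∧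
      (d₁ : ℝ) * p.1 + (d₂ : ℝ) * p.2 ≤ (n : ℝ) + 2 - (d : ℝ) ∧
      0 ≤ ((d₁ : ℝ) * ((n : ℝ) + 1) - ((n : ℝ) + 2 - (d : ℝ))) / ((d₁ : ℝ) * ((n : ℝ) + 1))
          - (n : ℝ) * p.1 / ((n : ℝ) + 1) + (d₂ : ℝ) * p.2 / ((d₁ : ℝ) * ((n : ℝ) + 1)) ∧
      0 ≤ ((d₂ : ℝ) * ((n : ℝ) + 1) - ((n : ℝ) + 2 - (d : ℝ))) / ((d₂ : ℝ) * ((n : ℝ) + 1))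
          - (n : ℝ) * p.2 / ((n : ℝ) + 1) + (d₁ : ℝ) * p.1 / ((d₂ : ℝ) * ((n : ℝ) + 1))} =
    convexHull ℝ
      {((0 : ℝ), (0 : ℝ)),
       ((((n : ℝ) + 1) * (d₁ : ℝ) - ((n : ℝ) + 2 - (d : ℝ))) / ((n : ℝ) * (d₁ : ℝ)), 0),
       (0, (((n : ℝ) + 1) * (d₂ : ℝ) - ((n : ℝ) + 2 - (d : ℝ))) / ((n : ℝ) * (d₂ : ℝ))),
       (((d₂ : ℝ) + (n : ℝ) * (d₁ : ℝ) - ((n : ℝ) + 2 - (d : ℝ))) / (((n : ℝ) - 1) * (d₁ : ℝ)),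
        ((d₁ : ℝ) + (n : ℝ) * (d₂ : ℝ) - ((n : ℝ) + 2 - (d : ℝ))) / (((n : ℝ) - 1) * (d₂ : ℝ)))} := by
  have hn' : (2 : ℝ) ≤ n := by exact_mod_cast hn
  have hd' : (1 : ℝ) ≤ d := by exact_mod_cast hd
  have ha : (1 : ℝ) ≤ d₁ := by exact_mod_cast hd₁
  have hb : (1 : ℝ) ≤ d₂ := by exact_mod_cast hd₂
  have hs : (d₁ : ℝ) + d₂ + d < n + 2 := by exact_mod_cast hsum
  generalize (n : ℝ) = n at *
  generalize (d₁ : ℝ) = a at *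
  generalize (d₂ : ℝ) = b at *
  obtain ⟨r, hr⟩ : ∃ r, r = n + 2 - (d : ℝ) := ⟨_, rfl⟩
  rw [← hr]
  have hn0 : 0 < n := by linarith
  have ha0 : 0 < a := by linarith
  have hb0 : 0 < b := by linarith
  have hn1 : 0 < n - 1 := by linarith
  have hp : 0 ≤ b + n * a - r := by nlinarith
  have hq : 0 ≤ a + n * b - r := by nlinarith
  have key := quadrilateral_eq_convexHull (n := n) (A := (n + 1) * a - r) (B := (n + 1) * b - r)
    (p := (b + n * a - r) / (n - 1)) (q := (a + n * b - r) / (n - 1)) (by linarith) ha0 hb0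
    (by nlinarith) (by nlinarith) (by positivity) (by positivity)
    (by field_simp; ring) (by field_simp; ring)
  rw [div_div, div_div] at key
  rw [← key]
  ext ⟨x, y⟩
  simp only [Set.mem_ofPred_eq, halfplane_iff hn0 ha0, halfplane_iff hn0 hb0]
  constructor
  · rintro ⟨h1, -, h2, -, -, h3, h4⟩
    exact ⟨h1, h2, h3, h4⟩
  · rintro ⟨h1, h2, h3, h4⟩
    have hn2 : 0 < n ^ 2 - 1 := by nlinarith
    have hu : a * x ≤ a := by
      refine le_of_mul_le_mul_left ?_ hn2
      have : 0 ≤ (n + 1) * (r - a - b) := mul_nonneg (by linarith) (by linarith)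
      linear_combination n * h3 + h4 + this
    have hv : b * y ≤ b := by
      refine le_of_mul_le_mul_left ?_ hn2
      have : 0 ≤ (n + 1) * (r - a - b) := mul_nonneg (by linarith) (by linarith)
      linear_combination n * h4 + h3 + this
    exact ⟨h1, (mul_le_iff_le_one_right ha0).1 hu, h2, (mul_le_iff_le_one_right hb0).1 hv,
      by linarith, h3, h4⟩
end

section
/- Let n ≥ 2 be an integer and let d, d₁, d₂ be positive integers with d₁ ≤ n+2-d, d₂ ≤ n+2-d and d₁ + d₂ ≥ n + 2 - d. Then the polytope Q(n,d,d₁,d₂) ⊆ ℝ² equals the convex hull of the five points (0,0), (((n+1)d₁-(n+2-d))/(n d₁), 0), (0, ((n+1)d₂-(n+2-d))/(n d₂)), (1, (n+2-d-d₁)/d₂), and ((n+2-d-d₂)/d₁, 1). (This is the combinatorial content of the computation of the K-semistable domain Kss(S_d, S_{d₁}|_{S_d}+S_{d₂}|_{S_d}) for general smooth hypersurfaces of degrees d, d₁, d₂ in ℙ^{n+1}.) -/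
/-- The defining inequality of `Q(n,d,d₁,d₂)` with denominators cleared. -/
lemma zero_le_sub_add_iff {n a b c x y : ℝ} (hn : 0 < n) (ha : 0 < a) :
    0 ≤ (a * (n + 1) - c) / (a * (n + 1)) - n * x / (n + 1) + b * y / (a * (n + 1)) ↔
      n * (a * x) - b * y ≤ (n + 1) * a - c := by
  have h : (a * (n + 1) - c) / (a * (n + 1)) - n * x / (n + 1) + b * y / (a * (n + 1)) =
      ((n + 1) * a - c - (n * (a * x) - b * y)) / (a * (n + 1)) := by
    field_simp
    ring
  rw [h, le_div_iff₀ (by positivity), zero_mul, sub_nonneg]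

lemma exists_convex_combination_eq {l r s : ℝ} (hl : l ≤ s) (hr : s ≤ r) :
    ∃ t u : ℝ, 0 ≤ t ∧ 0 ≤ u ∧ t + u = 1 ∧ t * l + u * r = s := by
  have h : s ∈ segment ℝ l r := by
    rw [segment_eq_Icc (hl.trans hr)]
    exact ⟨hl, hr⟩
  simpa [segment] using h

/-- A convex set containing `(0, 0)`, `(x₁, 0)` and `(1, y₃)` contains, on the line
`a * x + b * y = a * p + b * q`, a point whose first coordinate is at least `p`. -/
lemma exists_mem_level_le_fst {S : Set (ℝ × ℝ)} (hS : Convex ℝ S) {n a b c x₁ y₃ p q : ℝ}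
    (hn : 0 < n) (ha : 0 < a) (hb : 0 < b)
    (hx₁ : n * (a * x₁) = (n + 1) * a - c) (hy₃ : b * y₃ = c - a)
    (h0 : ((0 : ℝ), (0 : ℝ)) ∈ S) (h1 : (x₁, (0 : ℝ)) ∈ S) (h3 : ((1 : ℝ), y₃) ∈ S)
    (hp : 0 ≤ p) (hq : 0 ≤ q) (hc : a * p + b * q ≤ c)
    (hpq : n * (a * p) - b * q ≤ (n + 1) * a - c) :
    ∃ x y, (x, y) ∈ S ∧ a * x + b * y = a * p + b * q ∧ p ≤ x := by
  rcases le_total (a * p + b * q) (a * x₁) with h | h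
  · obtain ⟨t, u, ht, hu, htu, hs⟩ :=
      exists_convex_combination_eq (l := 0) (by positivity : 0 ≤ a * p + b * q) h
    refine ⟨u * x₁, 0, by simpa using hS h0 h1 ht hu htu, by linarith, ?_⟩
    have : 0 ≤ b * q := by positivity
    exact le_of_mul_le_mul_left (by linarith) ha
  · obtain ⟨t, u, ht, hu, htu, hs⟩ := exists_convex_combination_eq h hc
    have hxy : a * (t * x₁ + u) + b * (u * y₃) = a * p + b * q := by
      linear_combination hs + u * hy₃
    refine ⟨t * x₁ + u, u * y₃, by simpa using hS h1 h3 ht hu htu, hxy, ?_⟩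
    have hline : n * (a * (t * x₁ + u)) - b * (u * y₃) = (n + 1) * a - c := by
      linear_combination t * hx₁ - u * hy₃ + ((n + 1) * a - c) * htu
    refine le_of_mul_le_mul_left (a := (n + 1) * a) ?_ (by positivity)
    linarith

lemma polygon_eq_convexHull {n a b c x₁ y₂ y₃ x₄ : ℝ} (hn : 0 < n) (ha : 0 < a) (hb : 0 < b)
    (hac : a ≤ c) (hbc : b ≤ c) (hcab : c ≤ a + b)
    (hca : c ≤ (n + 1) * a) (hcb : c ≤ (n + 1) * b)
    (hx₁ : n * (a * x₁) = (n + 1) * a - c) (hy₂ : n * (b * y₂) = (n + 1) * b - c)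
    (hy₃ : b * y₃ = c - a) (hx₄ : a * x₄ = c - b) :
    {p : ℝ × ℝ | 0 ≤ p.1 ∧ p.1 ≤ 1 ∧ 0 ≤ p.2 ∧ p.2 ≤ 1 ∧ a * p.1 + b * p.2 ≤ c ∧
      n * (a * p.1) - b * p.2 ≤ (n + 1) * a - c ∧ n * (b * p.2) - a * p.1 ≤ (n + 1) * b - c} =
    convexHull ℝ {((0 : ℝ), (0 : ℝ)), (x₁, 0), (0, y₂), (1, y₃), (x₄, 1)} := by
  set V : Set (ℝ × ℝ) := {((0 : ℝ), (0 : ℝ)), (x₁, 0), (0, y₂), (1, y₃), (x₄, 1)}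
  have hV : V ⊆ convexHull ℝ V := subset_convexHull ℝ V
  have hconv := convex_convexHull ℝ V
  apply Set.Subset.antisymm
  · rintro ⟨p, q⟩ ⟨hp, -, hq, -, hc, h₁, h₂⟩
    obtain ⟨x, y, hxy, hlev, hpx⟩ := exists_mem_level_le_fst hconv hn ha hb hx₁ hy₃
      (hV (by simp [V])) (hV (by simp [V])) (hV (by simp [V])) hp hq hc h₁
    obtain ⟨y', x', hxy', hlev', hqy⟩ := exists_mem_level_le_fst
      (S := Prod.swap ⁻¹' convexHull ℝ V)
      (hconv.is_linear_preimage (LinearEquiv.prodComm ℝ ℝ ℝ).toLinearMap.isLinear) hn hb ha hy₂ hx₄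
      (hV (by simp [V])) (hV (by simp [V])) (hV (by simp [V])) hq hp (by linarith) h₂
    have hx'p : x' ≤ p := by
      have := mul_le_mul_of_nonneg_left hqy hb.le
      exact le_of_mul_le_mul_left (by linarith) ha
    obtain ⟨t, u, ht, hu, htu, hs⟩ := exists_convex_combination_eq hx'p hpx
    have hq' : t * y' + u * y = q := by
      apply mul_left_cancel₀ hb.ne'
      linear_combination t * hlev' + u * hlev - a * hs + (a * p + b * q) * htu
    have := hconv hxy' hxy ht hu htu
    simpa [hs, hq'] using this
  · have hx₁0 : 0 ≤ x₁ := by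
      by_contra! h
      nlinarith [mul_pos hn ha]
    have hx₁1 : x₁ ≤ 1 := le_of_mul_le_mul_left (by linarith) (mul_pos hn ha)
    have hy₂0 : 0 ≤ y₂ := by
      by_contra! h
      nlinarith [mul_pos hn hb]
    have hy₂1 : y₂ ≤ 1 := le_of_mul_le_mul_left (by linarith) (mul_pos hn hb)
    have hy₃0 : 0 ≤ y₃ := le_of_mul_le_mul_left (by linarith) hb
    have hy₃1 : y₃ ≤ 1 := le_of_mul_le_mul_left (by linarith) hb
    have hx₄0 : 0 ≤ x₄ := le_of_mul_le_mul_left (by linarith) ha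
    have hx₄1 : x₄ ≤ 1 := le_of_mul_le_mul_left (by linarith) ha
    have hax₁ : 0 ≤ a * x₁ := by positivity
    have hby₂ : 0 ≤ b * y₂ := by positivity
    have hax₁c := mul_le_mul_of_nonneg_left hx₁1 ha.le
    have hby₂c := mul_le_mul_of_nonneg_left hy₂1 hb.le
    have hn3 : n * (b * y₃) ≤ n * b := by
      gcongr
      linarith
    have hn4 : n * (a * x₄) ≤ n * a := by
      gcongr
      linarith
    refine convexHull_min ?_ ?_
    · rintro _ (rfl | rfl | rfl | rfl | rfl) <;>
        refine ⟨?_, ?_, ?_, ?_, ?_, ?_, ?_⟩ <;> dsimp only <;> linarith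
    · rintro ⟨p, q⟩ ⟨h₁, h₂, h₃, h₄, h₅, h₆, h₇⟩ ⟨p', q'⟩ ⟨h₁', h₂', h₃', h₄', h₅', h₆', h₇'⟩
        t u ht hu htu
      obtain rfl : u = 1 - t := by linarith
      have key {v w : ℝ} (hv : 0 ≤ v) (hw : 0 ≤ w) : 0 ≤ t * v + (1 - t) * w :=
        add_nonneg (mul_nonneg ht hv) (mul_nonneg hu hw)
      refine ⟨?_, ?_, ?_, ?_, ?_, ?_, ?_⟩ <;>
        simp only [Prod.smul_mk, Prod.mk_add_mk, smul_eq_mul]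
      · linarith [key h₁ h₁']
      · linarith [key (sub_nonneg.2 h₂) (sub_nonneg.2 h₂')]
      · linarith [key h₃ h₃']
      · linarith [key (sub_nonneg.2 h₄) (sub_nonneg.2 h₄')]
      · linarith [key (sub_nonneg.2 h₅) (sub_nonneg.2 h₅')]
      · linarith [key (sub_nonneg.2 h₆) (sub_nonneg.2 h₆')]
      · linarith [key (sub_nonneg.2 h₇) (sub_nonneg.2 h₇')]

/-- The K-semistable domain `Kss(S_d, S_{d₁}|_{S_d}+S_{d₂}|_{S_d})` in the case
`d₁ + d₂ ≥ n + 2 - d`: the polytope `Q(n,d,d₁,d₂)` equals the convex hull of five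
explicit points. -/
theorem kss_domain_Sd_two_divisors_ge (n d d₁ d₂ : ℕ) (hn : 2 ≤ n)
    (hd : 0 < d) (hd₁ : 0 < d₁) (hd₂ : 0 < d₂)
    (hd₁' : d₁ + d ≤ n + 2) (hd₂' : d₂ + d ≤ n + 2) (hsum : n + 2 ≤ d₁ + d₂ + d) :
    {p : ℝ × ℝ | 0 ≤ p.1 ∧ p.1 ≤ 1 ∧ 0 ≤ p.2 ∧ p.2 ≤ 1 ∧
      (d₁ : ℝ) * p.1 + (d₂ : ℝ) * p.2 ≤ (n : ℝ) + 2 - (d : ℝ) ∧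
      0 ≤ ((d₁ : ℝ) * ((n : ℝ) + 1) - ((n : ℝ) + 2 - (d : ℝ))) / ((d₁ : ℝ) * ((n : ℝ) + 1))
          - (n : ℝ) * p.1 / ((n : ℝ) + 1) + (d₂ : ℝ) * p.2 / ((d₁ : ℝ) * ((n : ℝ) + 1)) ∧
      0 ≤ ((d₂ : ℝ) * ((n : ℝ) + 1) - ((n : ℝ) + 2 - (d : ℝ))) / ((d₂ : ℝ) * ((n : ℝ) + 1))
          - (n : ℝ) * p.2 / ((n : ℝ) + 1) + (d₁ : ℝ) * p.1 / ((d₂ : ℝ) * ((n : ℝ) + 1))} =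
    convexHull ℝ
      {((0 : ℝ), (0 : ℝ)),
       ((((n : ℝ) + 1) * (d₁ : ℝ) - ((n : ℝ) + 2 - (d : ℝ))) / ((n : ℝ) * (d₁ : ℝ)), 0),
       (0, (((n : ℝ) + 1) * (d₂ : ℝ) - ((n : ℝ) + 2 - (d : ℝ))) / ((n : ℝ) * (d₂ : ℝ))),
       (1, ((n : ℝ) + 2 - (d : ℝ) - (d₁ : ℝ)) / (d₂ : ℝ)),
       (((n : ℝ) + 2 - (d : ℝ) - (d₂ : ℝ)) / (d₁ : ℝ), 1)} := by
  have hn' : (0 : ℝ) < n := by exact_mod_cast (by omega : 0 < n)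
  have h₁ : (1 : ℝ) ≤ d₁ := by exact_mod_cast hd₁
  have h₂ : (1 : ℝ) ≤ d₂ := by exact_mod_cast hd₂
  have hd1 : (1 : ℝ) ≤ d := by exact_mod_cast hd
  have ha : (0 : ℝ) < d₁ := by linarith
  have hb : (0 : ℝ) < d₂ := by linarith
  have hac : (d₁ : ℝ) + d ≤ n + 2 := by exact_mod_cast hd₁'
  have hbc : (d₂ : ℝ) + d ≤ n + 2 := by exact_mod_cast hd₂'
  have hcab : (n : ℝ) + 2 ≤ d₁ + d₂ + d := by exact_mod_cast hsum
  simp only [zero_le_sub_add_iff hn' ha, zero_le_sub_add_iff hn' hb]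
  apply polygon_eq_convexHull hn' ha hb <;> first | nlinarith | field_simp
end

section
/- Let n ≥ 2 be an integer and let d, d₁, d₂, d₃ be positive integers with d₂ + d₃ < n + 3 - d - d₁. Then the polytope R(n,d,d₁,d₂,d₃) ⊆ ℝ² equals the convex hull of the four points (0,0), (((n+1)d₂-(n+3-d-d₁))/(n d₂), 0), (0, ((n+1)d₃-(n+3-d-d₁))/(n d₃)), and ((n d₂+d₁+d₃-(n+3-d))/((n-1)d₂), (n d₃+d₁+d₂-(n+3-d))/((n-1)d₃)). (This is the combinatorial content of the computation of the K-semistable domain Kss(S_{d₁}|_{S_d}, (S_{d₂}|_{S_d})|_{S_{d₁}|_{S_d}} + (S_{d₃}|_{S_d})|_{S_{d₁}|_{S_d}}) for general smooth hypersurfaces of degrees d, d₁, d₂, d₃ in ℙ^{n+2}.) -/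
/-- Barycentric weights, over the triangle `(0,0), (p,0), (s,t)`, of a point below the diagonal. -/
lemma exists_weights_below_diagonal {n p s t u v : ℝ} (hn : 0 < n)
    (hp : 0 ≤ p) (ht : 0 < t) (hs : n * s = n * p + t)
    (hv : 0 ≤ v) (hvt : v ≤ t) (huv : n * u ≤ n * p + v) (hdiag : v * s ≤ u * t) :
    ∃ α β : ℝ, 0 ≤ α ∧ 0 ≤ β ∧ α + β ≤ 1 ∧ u = α * p + β * s ∧ v = β * t := by
  have hs' : s = p + t / n := by field_simp; linarith
  have hu' : u ≤ p + v / n := by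
    have : u = n * u / n := by field_simp
    rw [this, show p + v / n = (n * p + v) / n by field_simp]
    gcongr
  have hβ : v / t * t = v := div_mul_cancel₀ v ht.ne'
  have hβ1 : v / t ≤ 1 := (div_le_one ht).2 hvt
  have hβs : v / t * s = v / t * p + v / n := by rw [hs']; field_simp
  have hlow : v / t * s ≤ u := by
    rw [div_mul_eq_mul_div, div_le_iff₀ ht]; exact hdiag
  rcases hp.eq_or_lt with rfl | hp
  · refine ⟨0, v / t, le_rfl, by positivity, by linarith, ?_, hβ.symm⟩
    linarith
  · refine ⟨(u - v / t * s) / p, v / t, div_nonneg (by linarith) hp.le, by positivity, ?_, ?_,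
      hβ.symm⟩
    · have : (u - v / t * s) / p ≤ 1 - v / t := by
        rw [div_le_iff₀ hp]; linarith
      linarith
    · field_simp; ring

/-- Every point of the quadrilateral cut out by `n u ≤ n p + v` and `n v ≤ n q + u` in the
positive quadrant is a subconvex combination of its nonzero vertices. -/
lemma exists_weights_quadrilateral {n p q s t u v : ℝ} (hn : 1 < n)
    (hp : 0 ≤ p) (hq : 0 ≤ q) (hs : n * s = n * p + t) (ht : n * t = n * q + s)
    (hu : 0 ≤ u) (hv : 0 ≤ v) (huv : n * u ≤ n * p + v) (hvu : n * v ≤ n * q + u) :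
    ∃ α β γ : ℝ, 0 ≤ α ∧ 0 ≤ β ∧ 0 ≤ γ ∧ α + β + γ ≤ 1 ∧
      u = α * p + γ * s ∧ v = β * q + γ * t := by
  have hn0 : 0 < n := by linarith
  have hn1 : 0 < n ^ 2 - 1 := by nlinarith
  have hus : u ≤ s := by
    refine le_of_mul_le_mul_left ?_ hn1
    nlinarith
  have hvt : v ≤ t := by
    refine le_of_mul_le_mul_left ?_ hn1
    nlinarith
  rcases (hu.trans hus).eq_or_lt with h0 | hspos
  · subst h0
    have hnp : 0 ≤ n * p := by positivity
    obtain rfl : u = 0 := by linarith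
    obtain rfl : v = 0 := by linarith
    exact ⟨0, 0, 0, by norm_num⟩
  have htpos : 0 < t := by
    have : 0 ≤ n * q := by positivity
    have : 0 < n * t := by linarith
    exact pos_of_mul_pos_right this hn0.le
  rcases le_total (v * s) (u * t) with h | h
  · obtain ⟨α, γ, hα, hγ, hsum, h1, h2⟩ :=
      exists_weights_below_diagonal hn0 hp htpos hs hv hvt huv h
    exact ⟨α, 0, γ, hα, le_rfl, hγ, by linarith, h1, by linarith⟩
  · obtain ⟨β, γ, hβ, hγ, hsum, h1, h2⟩ :=
      exists_weights_below_diagonal hn0 hq hspos ht hu hus hvu h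
    exact ⟨0, β, γ, le_rfl, hβ, hγ, by linarith, by linarith, h1⟩

/-- A subconvex combination of three points lies in the convex hull of these and the origin. -/
lemma mem_convexHull_zero_of_subconvex {E : Type*} [AddCommGroup E] [Module ℝ E] {x y z : E}
    {α β γ : ℝ} (hα : 0 ≤ α) (hβ : 0 ≤ β) (hγ : 0 ≤ γ) (h : α + β + γ ≤ 1) :
    α • x + β • y + γ • z ∈ convexHull ℝ {0, x, y, z} := by
  have key := (convex_convexHull ℝ ({0, x, y, z} : Set E)).sum_mem
    (t := Finset.univ) (w := ![1 - (α + β + γ), α, β, γ]) (z := ![0, x, y, z])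
    (by intro i _; fin_cases i <;> simp <;> linarith)
    (by simp [Fin.sum_univ_four]; ring)
    (by intro i _; apply subset_convexHull; fin_cases i <;> simp)
  simpa [Fin.sum_univ_four] using key

lemma convex_setOf_linear_le (a b c : ℝ) : Convex ℝ {p : ℝ × ℝ | a * p.1 + b * p.2 ≤ c} :=
  convex_halfSpace_le (f := fun p : ℝ × ℝ => a * p.1 + b * p.2)
    ⟨fun x y => by simp; ring, fun k x => by simp; ring⟩ c

/-- The polytope in real parameters, with the denominators cleared and the redundant
inequalities removed, is the convex hull of its vertices. -/
lemma quadrilateral_eq_convexHull_s4 {n r a b : ℝ} (hn : 1 < n) (ha : 0 < a) (hb : 0 < b)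
    (hra : r ≤ (n + 1) * a) (hrb : r ≤ (n + 1) * b)
    (hsa : r ≤ n * a + b) (hsb : r ≤ n * b + a) :
    {p : ℝ × ℝ | 0 ≤ p.1 ∧ 0 ≤ p.2 ∧ n * (a * p.1) ≤ (n + 1) * a - r + b * p.2 ∧
      n * (b * p.2) ≤ (n + 1) * b - r + a * p.1} =
    convexHull ℝ {(0, 0), (((n + 1) * a - r) / (n * a), 0), (0, ((n + 1) * b - r) / (n * b)),
      ((n * a + b - r) / ((n - 1) * a), (n * b + a - r) / ((n - 1) * b))} := by
  have hn0 : 0 < n := by linarith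
  have hn1 : 0 < n - 1 := by linarith
  apply Set.Subset.antisymm
  · rintro ⟨x, y⟩ ⟨hx, hy, h1, h2⟩
    dsimp only at hx hy h1 h2
    obtain ⟨α, β, γ, hα, hβ, hγ, hsum, hu, hv⟩ :=
      exists_weights_quadrilateral (n := n) (p := ((n + 1) * a - r) / n)
        (q := ((n + 1) * b - r) / n) (s := (n * a + b - r) / (n - 1))
        (t := (n * b + a - r) / (n - 1)) (u := a * x) (v := b * y) hn
        (div_nonneg (by linarith) hn0.le) (div_nonneg (by linarith) hn0.le)
        (by field_simp; ring) (by field_simp; ring) (by positivity) (by positivity)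
        (by rwa [mul_div_cancel₀ _ hn0.ne']) (by rwa [mul_div_cancel₀ _ hn0.ne'])
    have key := mem_convexHull_zero_of_subconvex
      (x := ((((n + 1) * a - r) / (n * a), 0) : ℝ × ℝ)) (y := (0, ((n + 1) * b - r) / (n * b)))
      (z := ((n * a + b - r) / ((n - 1) * a), (n * b + a - r) / ((n - 1) * b))) hα hβ hγ hsum
    refine Eq.subst (motive := (· ∈ convexHull ℝ _)) (Eq.symm ?_) key
    ext
    · simp only [Prod.fst_add, Prod.smul_fst, smul_eq_mul, mul_zero, add_zero]
      rw [← mul_right_inj' ha.ne', hu]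
      field_simp
    · simp only [Prod.snd_add, Prod.smul_snd, smul_eq_mul, mul_zero, zero_add]
      rw [← mul_right_inj' hb.ne', hv]
      field_simp
  · apply convexHull_min
    · have hp : a * (((n + 1) * a - r) / (n * a)) = ((n + 1) * a - r) / n := by field_simp
      have hq : b * (((n + 1) * b - r) / (n * b)) = ((n + 1) * b - r) / n := by field_simp
      have hp0 : 0 ≤ ((n + 1) * a - r) / n := div_nonneg (by linarith) hn0.le
      have hq0 : 0 ≤ ((n + 1) * b - r) / n := div_nonneg (by linarith) hn0.le
      rintro _ (rfl | rfl | rfl | rfl)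
      · simp; constructor <;> linarith
      · refine ⟨div_nonneg (by linarith) (by positivity), le_rfl, ?_, ?_⟩
        · simp only [hp]; field_simp; linarith
        · simp only [hp]; linarith
      · refine ⟨le_rfl, div_nonneg (by linarith) (by positivity), ?_, ?_⟩
        · simp only [hq]; linarith
        · simp only [hq]; field_simp; linarith
      · refine ⟨div_nonneg (by linarith) (by positivity), div_nonneg (by linarith) (by positivity),
          le_of_eq ?_, le_of_eq ?_⟩ <;> (dsimp only; field_simp; ring)
    · have key := ((convex_setOf_linear_le (-1) 0 0).inter (convex_setOf_linear_le 0 (-1) 0)).inter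
        ((convex_setOf_linear_le (n * a) (-b) ((n + 1) * a - r)).inter
          (convex_setOf_linear_le (-a) (n * b) ((n + 1) * b - r)))
      convert! key using 1
      ext ⟨x, y⟩
      simp only [Set.mem_ofPred_eq, Set.mem_inter_iff]
      constructor
      · rintro ⟨h1, h2, h3, h4⟩
        refine ⟨⟨?_, ?_⟩, ?_, ?_⟩ <;> linarith
      · rintro ⟨⟨h1, h2⟩, h3, h4⟩
        refine ⟨?_, ?_, ?_, ?_⟩ <;> linarith

lemma nonneg_facet_iff {n r a b x y : ℝ} (hn : 0 < n + 1) (ha : 0 < a) :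
    0 ≤ (a * (n + 1) - r) / (a * (n + 1)) - n * x / (n + 1) + b * y / (a * (n + 1)) ↔
      n * (a * x) ≤ (n + 1) * a - r + b * y := by
  have h : (a * (n + 1) - r) / (a * (n + 1)) - n * x / (n + 1) + b * y / (a * (n + 1)) =
      ((n + 1) * a - r + b * y - n * (a * x)) / (a * (n + 1)) := by
    field_simp; ring
  rw [h, le_div_iff₀ (by positivity), zero_mul, sub_nonneg]


/-- The K-semistable domain
`Kss(S_{d₁}|_{S_d}, (S_{d₂}|_{S_d})|_{S_{d₁}|_{S_d}} + (S_{d₃}|_{S_d})|_{S_{d₁}|_{S_d}})`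
in the case `d₂ + d₃ < n + 3 - d - d₁`: the polytope `R(n,d,d₁,d₂,d₃)` equals the convex
hull of four explicit points. -/
theorem kss_domain_SdSd1_two_divisors_lt (n d d₁ d₂ d₃ : ℕ) (hn : 2 ≤ n)
    (hd : 0 < d) (hd₁ : 0 < d₁) (hd₂ : 0 < d₂) (hd₃ : 0 < d₃)
    (hsum : d₂ + d₃ + d + d₁ < n + 3) :
    {p : ℝ × ℝ | 0 ≤ p.1 ∧ p.1 ≤ 1 ∧ 0 ≤ p.2 ∧ p.2 ≤ 1 ∧
      (d₂ : ℝ) * p.1 + (d₃ : ℝ) * p.2 ≤ (n : ℝ) + 3 - (d : ℝ) - (d₁ : ℝ) ∧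
      0 ≤ ((d₂ : ℝ) * ((n : ℝ) + 1) - ((n : ℝ) + 3 - (d : ℝ) - (d₁ : ℝ)))
            / ((d₂ : ℝ) * ((n : ℝ) + 1))
          - (n : ℝ) * p.1 / ((n : ℝ) + 1) + (d₃ : ℝ) * p.2 / ((d₂ : ℝ) * ((n : ℝ) + 1)) ∧
      0 ≤ ((d₃ : ℝ) * ((n : ℝ) + 1) - ((n : ℝ) + 3 - (d : ℝ) - (d₁ : ℝ)))
            / ((d₃ : ℝ) * ((n : ℝ) + 1))
          - (n : ℝ) * p.2 / ((n : ℝ) + 1) + (d₂ : ℝ) * p.1 / ((d₃ : ℝ) * ((n : ℝ) + 1))} =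
    convexHull ℝ
      {((0 : ℝ), (0 : ℝ)),
       ((((n : ℝ) + 1) * (d₂ : ℝ) - ((n : ℝ) + 3 - (d : ℝ) - (d₁ : ℝ))) / ((n : ℝ) * (d₂ : ℝ)), 0),
       (0, (((n : ℝ) + 1) * (d₃ : ℝ) - ((n : ℝ) + 3 - (d : ℝ) - (d₁ : ℝ))) / ((n : ℝ) * (d₃ : ℝ))),
       (((n : ℝ) * (d₂ : ℝ) + (d₁ : ℝ) + (d₃ : ℝ) - ((n : ℝ) + 3 - (d : ℝ)))
          / (((n : ℝ) - 1) * (d₂ : ℝ)),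
        ((n : ℝ) * (d₃ : ℝ) + (d₁ : ℝ) + (d₂ : ℝ) - ((n : ℝ) + 3 - (d : ℝ)))
          / (((n : ℝ) - 1) * (d₃ : ℝ)))} := by
  have hn' : (2 : ℝ) ≤ n := by exact_mod_cast hn
  have h0 : (1 : ℝ) ≤ d := by exact_mod_cast hd
  have h1 : (1 : ℝ) ≤ d₁ := by exact_mod_cast hd₁
  have h2 : (1 : ℝ) ≤ d₂ := by exact_mod_cast hd₂
  have h3 : (1 : ℝ) ≤ d₃ := by exact_mod_cast hd₃
  have hs : (d₂ : ℝ) + d₃ + d + d₁ < n + 3 := by exact_mod_cast hsum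
  generalize (n : ℝ) = n at *
  generalize (d : ℝ) = d at *
  generalize (d₁ : ℝ) = d₁ at *
  generalize (d₂ : ℝ) = a at *
  generalize (d₃ : ℝ) = b at *
  have key := quadrilateral_eq_convexHull_s4 (n := n) (r := n + 3 - d - d₁) (a := a) (b := b)
    (by linarith) (by linarith) (by linarith) (by nlinarith) (by nlinarith)
    (by nlinarith) (by nlinarith)
  rw [show n * a + d₁ + b - (n + 3 - d) = n * a + b - (n + 3 - d - d₁) by ring,
    show n * b + d₁ + a - (n + 3 - d) = n * b + a - (n + 3 - d - d₁) by ring, ← key]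
  ext ⟨x, y⟩
  simp only [Set.mem_ofPred_eq, nonneg_facet_iff (show 0 < n + 1 by linarith)
    (show 0 < a by linarith), nonneg_facet_iff (show 0 < n + 1 by linarith)
    (show 0 < b by linarith)]
  constructor
  · rintro ⟨hx, -, hy, -, -, h4, h5⟩
    exact ⟨hx, hy, h4, h5⟩
  · rintro ⟨hx, hy, h4, h5⟩
    have hxa : a * x ≤ a := by
      refine le_of_mul_le_mul_left ?_ (show 0 < n ^ 2 - 1 by nlinarith)
      nlinarith
    have hyb : b * y ≤ b := by
      refine le_of_mul_le_mul_left ?_ (show 0 < n ^ 2 - 1 by nlinarith)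
      nlinarith
    exact ⟨hx, by nlinarith, hy, by nlinarith, by linarith, h4, h5⟩
end

section
/- Let n ≥ 2 be an integer and let d, d₁, d₂, d₃ be positive integers with d₂ ≤ n+3-d-d₁, d₃ ≤ n+3-d-d₁ and d₂ + d₃ ≥ n + 3 - d - d₁. Then the polytope R(n,d,d₁,d₂,d₃) ⊆ ℝ² equals the convex hull of the five points (0,0), (((n+1)d₂-(n+3-d-d₁))/(n d₂), 0), (0, ((n+1)d₃-(n+3-d-d₁))/(n d₃)), (1, (n+3-d-d₁-d₂)/d₃), and ((n+3-d-d₁-d₃)/d₂, 1). (This is the combinatorial content of the computation of the K-semistable domain Kss(S_{d₁}|_{S_d}, (S_{d₂}|_{S_d})|_{S_{d₁}|_{S_d}} + (S_{d₃}|_{S_d})|_{S_{d₁}|_{S_d}}) for general smooth hypersurfaces of degrees d, d₁, d₂, d₃ in ℙ^{n+2}.) -/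
/-- The triangle with vertices `0`, `(((n + 1) a - m) / n, 0)`, `(a, m - a)` contains every point
of the cone below its third vertex on the correct side of the opposite edge. -/
lemma exists_coeffs_lower_triangle {n a m u v : ℝ} (hn : 0 < n) (ha : 0 < a) (ham : a ≤ m)
    (hma : m ≤ (n + 1) * a) (hu : 0 ≤ u) (hv : 0 ≤ v) (huv : u + v ≤ m)
    (hedge : 0 ≤ (n + 1) * a - m - n * u + v) (hcone : a * v ≤ (m - a) * u) :
    ∃ s t : ℝ, 0 ≤ s ∧ 0 ≤ t ∧ s + t ≤ 1 ∧
      u = s * (((n + 1) * a - m) / n) + t * a ∧ v = t * (m - a) := by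
  rcases ham.eq_or_lt with rfl | ham
  · have hv0 : v = 0 := by nlinarith
    subst hv0
    refine ⟨0, u / a, le_rfl, by positivity, ?_, by field_simp; ring, by ring⟩
    rw [zero_add, div_le_one ha]
    nlinarith
  rcases hma.eq_or_lt with rfl | hma
  · have hvu : v = n * u := by
      apply le_antisymm
      · nlinarith
      · linarith
    subst hvu
    refine ⟨0, u / a, le_rfl, by positivity, ?_, by field_simp; ring, by field_simp; ring⟩
    rw [zero_add, div_le_one ha]
    nlinarith
  have h₁ : 0 < m - a := sub_pos.2 ham
  have h₂ : 0 < (n + 1) * a - m := sub_pos.2 hma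
  have h₂' : a * (n + 1) - m ≠ 0 := mul_comm a (n + 1) ▸ h₂.ne'
  refine ⟨n * ((m - a) * u - a * v) / (((n + 1) * a - m) * (m - a)), v / (m - a),
    div_nonneg (mul_nonneg hn.le (sub_nonneg.2 hcone)) (by positivity), by positivity, ?_, ?_, ?_⟩
  · rw [← sub_nonneg]
    have : 1 - (n * ((m - a) * u - a * v) / (((n + 1) * a - m) * (m - a)) + v / (m - a)) =
        ((n + 1) * a - m - n * u + v) / ((n + 1) * a - m) := by
      field_simp
      ring
    rw [this]
    positivity
  · field_simp
    ring
  · field_simp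

/-- The triangle with vertices `0`, `(a, m - a)`, `(m - b, b)` contains every point of the cone
spanned by its vertices with `u + v ≤ m`. -/
lemma exists_coeffs_middle_triangle {a b m u v : ℝ} (ha : 0 < a) (hb : 0 < b) (ham : a ≤ m)
    (hsum : m ≤ a + b) (hu : 0 ≤ u) (huv : u + v ≤ m)
    (hA : (m - a) * u ≤ a * v) (hB : (m - b) * v ≤ b * u) :
    ∃ s t : ℝ, 0 ≤ s ∧ 0 ≤ t ∧ s + t ≤ 1 ∧
      u = s * a + t * (m - b) ∧ v = s * (m - a) + t * b := by
  rcases hsum.eq_or_lt with rfl | hsum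
  · have hvu : a * v = b * u := by linarith
    have hv : v = b * u / a := by field_simp; linarith
    refine ⟨u / a, 0, by positivity, le_rfl, ?_, by field_simp; ring, by rw [hv]; ring⟩
    rw [add_zero, div_le_one ha]
    nlinarith
  have hm : 0 < m := ha.trans_le ham
  have hdet : 0 < a + b - m := sub_pos.2 hsum
  refine ⟨(b * u - (m - b) * v) / (m * (a + b - m)), (a * v - (m - a) * u) / (m * (a + b - m)),
    div_nonneg (sub_nonneg.2 hB) (by positivity), div_nonneg (sub_nonneg.2 hA) (by positivity),
    ?_, ?_, ?_⟩
  · rw [← add_div, div_le_one (by positivity)]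
    nlinarith
  · field_simp
    ring
  · field_simp
    ring

lemma mem_convexHull_of_zero_mem {E : Type*} [AddCommGroup E] [Module ℝ E] {S : Set E}
    {x y : E} (h0 : 0 ∈ S) (hx : x ∈ S) (hy : y ∈ S) {s t : ℝ} (hs : 0 ≤ s) (ht : 0 ≤ t)
    (hst : s + t ≤ 1) : s • x + t • y ∈ convexHull ℝ S := by
  have hmem := (convex_convexHull ℝ S).sum_mem (t := Finset.univ) (w := ![s, t, 1 - s - t])
    (z := ![x, y, 0])
    (by intro i _; fin_cases i <;> simp <;> linarith)
    (by simp [Fin.sum_univ_three])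
    (by intro i _; fin_cases i <;> exact subset_convexHull ℝ S (by assumption))
  simpa [Fin.sum_univ_three] using hmem

/-- The pentagon cut out by two coordinate half-planes, `a x + b y ≤ m` and two further linear
inequalities is the convex hull of its vertices. -/
lemma pentagon_eq_convexHull {n a b m : ℝ} (hn : 0 < n) (ha : 0 < a) (hb : 0 < b)
    (ham : a ≤ m) (hbm : b ≤ m) (hsum : m ≤ a + b)
    (hma : m ≤ (n + 1) * a) (hmb : m ≤ (n + 1) * b) :
    {p : ℝ × ℝ | 0 ≤ p.1 ∧ 0 ≤ p.2 ∧ a * p.1 + b * p.2 ≤ m ∧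
      0 ≤ (n + 1) * a - m - n * (a * p.1) + b * p.2 ∧
      0 ≤ (n + 1) * b - m - n * (b * p.2) + a * p.1} =
    convexHull ℝ {((0 : ℝ), (0 : ℝ)), (((n + 1) * a - m) / (n * a), 0),
      (0, ((n + 1) * b - m) / (n * b)), (1, (m - a) / b), ((m - b) / a, 1)} := by
  apply Set.Subset.antisymm
  · rintro ⟨x, y⟩ ⟨hx, hy, hxy, h₁, h₂⟩
    dsimp only at hx hy hxy h₁ h₂
    rcases le_total (a * (b * y)) ((m - a) * (a * x)) with hA | hA
    · obtain ⟨s, t, hs, ht, hst, hu, hv⟩ := exists_coeffs_lower_triangle hn ha ham hma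
        (by positivity) (by positivity) hxy h₁ hA
      have hxy' : ((x, y) : ℝ × ℝ) =
          s • (((n + 1) * a - m) / (n * a), (0 : ℝ)) + t • ((1 : ℝ), (m - a) / b) := by
        ext
        · apply mul_left_cancel₀ ha.ne'
          simp only [Prod.fst_add, Prod.smul_fst, smul_eq_mul]
          rw [hu]
          field_simp
        · apply mul_left_cancel₀ hb.ne'
          simp only [Prod.snd_add, Prod.smul_snd, smul_eq_mul]
          rw [hv]
          field_simp
          ring
      rw [hxy']
      exact mem_convexHull_of_zero_mem (by simp [Prod.zero_eq_mk]) (by simp) (by simp) hs ht hst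
    rcases le_total (b * (a * x)) ((m - b) * (b * y)) with hB | hB
    · obtain ⟨s, t, hs, ht, hst, hv, hu⟩ := exists_coeffs_lower_triangle hn hb hbm hmb
        (by positivity) (by positivity) (by linarith) h₂ hB
      have hxy' : ((x, y) : ℝ × ℝ) =
          s • ((0 : ℝ), ((n + 1) * b - m) / (n * b)) + t • ((m - b) / a, (1 : ℝ)) := by
        ext
        · apply mul_left_cancel₀ ha.ne'
          simp only [Prod.fst_add, Prod.smul_fst, smul_eq_mul]
          rw [hu]
          field_simp
          ring
        · apply mul_left_cancel₀ hb.ne'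
          simp only [Prod.snd_add, Prod.smul_snd, smul_eq_mul]
          rw [hv]
          field_simp
      rw [hxy']
      exact mem_convexHull_of_zero_mem (by simp [Prod.zero_eq_mk]) (by simp) (by simp) hs ht hst
    · obtain ⟨s, t, hs, ht, hst, hu, hv⟩ := exists_coeffs_middle_triangle ha hb ham hsum
        (by positivity) hxy hA hB
      have hxy' : ((x, y) : ℝ × ℝ) =
          s • ((1 : ℝ), (m - a) / b) + t • ((m - b) / a, (1 : ℝ)) := by
        ext
        · apply mul_left_cancel₀ ha.ne'
          simp only [Prod.fst_add, Prod.smul_fst, smul_eq_mul]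
          rw [hu]
          field_simp
        · apply mul_left_cancel₀ hb.ne'
          simp only [Prod.snd_add, Prod.smul_snd, smul_eq_mul]
          rw [hv]
          field_simp
      rw [hxy']
      exact mem_convexHull_of_zero_mem (by simp [Prod.zero_eq_mk]) (by simp) (by simp) hs ht hst
  · apply convexHull_min
    · have hp : a * (((n + 1) * a - m) / (n * a)) = ((n + 1) * a - m) / n := by field_simp
      have hq : b * (((n + 1) * b - m) / (n * b)) = ((n + 1) * b - m) / n := by field_simp
      have hp' : n * (((n + 1) * a - m) / n) = (n + 1) * a - m := by field_simp
      have hq' : n * (((n + 1) * b - m) / n) = (n + 1) * b - m := by field_simp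
      have hA : b * ((m - a) / b) = m - a := by field_simp
      have hB : a * ((m - b) / a) = m - b := by field_simp
      have hp0 : 0 ≤ ((n + 1) * a - m) / n := div_nonneg (sub_nonneg.2 hma) hn.le
      have hq0 : 0 ≤ ((n + 1) * b - m) / n := div_nonneg (sub_nonneg.2 hmb) hn.le
      have hpm : ((n + 1) * a - m) / n ≤ m := by
        rw [div_le_iff₀ hn]
        nlinarith
      have hqm : ((n + 1) * b - m) / n ≤ m := by
        rw [div_le_iff₀ hn]
        nlinarith
      have hdet : 0 ≤ (n + 1) * (a + b - m) := mul_nonneg (by linarith) (by linarith)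
      rintro p (rfl | rfl | rfl | rfl | rfl) <;>
        simp only [Set.mem_ofPred_eq, mul_zero, mul_one, hp, hq, hp', hq', hA, hB]
      · refine ⟨le_rfl, le_rfl, ?_, ?_, ?_⟩ <;> linarith
      · refine ⟨div_nonneg (sub_nonneg.2 hma) (by positivity), le_rfl, ?_, ?_, ?_⟩ <;> linarith
      · refine ⟨le_rfl, div_nonneg (sub_nonneg.2 hmb) (by positivity), ?_, ?_, ?_⟩ <;> linarith
      · refine ⟨zero_le_one, div_nonneg (sub_nonneg.2 ham) hb.le, ?_, ?_, ?_⟩ <;> linarith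
      · refine ⟨div_nonneg (sub_nonneg.2 hbm) ha.le, zero_le_one, ?_, ?_, ?_⟩ <;> linarith
    · rintro ⟨x, y⟩ ⟨h₁, h₂, h₃, h₄, h₅⟩ ⟨x', y'⟩ ⟨h₁', h₂', h₃', h₄', h₅'⟩ s t hs ht hst
      dsimp only at h₁ h₂ h₃ h₄ h₅ h₁' h₂' h₃' h₄' h₅'
      obtain rfl : t = 1 - s := by linarith
      simp only [Set.mem_ofPred_eq, Prod.smul_mk, Prod.mk_add_mk, smul_eq_mul]
      refine ⟨by positivity, by positivity, ?_, ?_, ?_⟩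
      · linarith [mul_nonneg hs (sub_nonneg.2 h₃), mul_nonneg ht (sub_nonneg.2 h₃')]
      · linarith [mul_nonneg hs h₄, mul_nonneg ht h₄']
      · linarith [mul_nonneg hs h₅, mul_nonneg ht h₅']

/-- Clearing denominators in the last two inequalities defining the K-semistable domain. -/
lemma edge_inequality_iff {n a m x w : ℝ} (hn : 0 < n) (ha : 0 < a) :
    0 ≤ (a * (n + 1) - m) / (a * (n + 1)) - n * x / (n + 1) + w / (a * (n + 1)) ↔
      0 ≤ (n + 1) * a - m - n * (a * x) + w := by
  have h : (a * (n + 1) - m) / (a * (n + 1)) - n * x / (n + 1) + w / (a * (n + 1)) =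
      ((n + 1) * a - m - n * (a * x) + w) / (a * (n + 1)) := by
    field_simp
  rw [h, le_div_iff₀ (by positivity), zero_mul]

/-- The K-semistable domain
`Kss(S_{d₁}|_{S_d}, (S_{d₂}|_{S_d})|_{S_{d₁}|_{S_d}} + (S_{d₃}|_{S_d})|_{S_{d₁}|_{S_d}})`
in the case `d₂ + d₃ ≥ n + 3 - d - d₁`: the polytope `R(n,d,d₁,d₂,d₃)` equals the convex
hull of five explicit points. -/
theorem kss_domain_SdSd1_two_divisors_ge (n d d₁ d₂ d₃ : ℕ) (hn : 2 ≤ n)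
    (hd : 0 < d) (hd₁ : 0 < d₁) (hd₂ : 0 < d₂) (hd₃ : 0 < d₃)
    (hd₂' : d₂ + d + d₁ ≤ n + 3) (hd₃' : d₃ + d + d₁ ≤ n + 3)
    (hsum : n + 3 ≤ d₂ + d₃ + d + d₁) :
    {p : ℝ × ℝ | 0 ≤ p.1 ∧ p.1 ≤ 1 ∧ 0 ≤ p.2 ∧ p.2 ≤ 1 ∧
      (d₂ : ℝ) * p.1 + (d₃ : ℝ) * p.2 ≤ (n : ℝ) + 3 - (d : ℝ) - (d₁ : ℝ) ∧
      0 ≤ ((d₂ : ℝ) * ((n : ℝ) + 1) - ((n : ℝ) + 3 - (d : ℝ) - (d₁ : ℝ)))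
            / ((d₂ : ℝ) * ((n : ℝ) + 1))
          - (n : ℝ) * p.1 / ((n : ℝ) + 1) + (d₃ : ℝ) * p.2 / ((d₂ : ℝ) * ((n : ℝ) + 1)) ∧
      0 ≤ ((d₃ : ℝ) * ((n : ℝ) + 1) - ((n : ℝ) + 3 - (d : ℝ) - (d₁ : ℝ)))
            / ((d₃ : ℝ) * ((n : ℝ) + 1))
          - (n : ℝ) * p.2 / ((n : ℝ) + 1) + (d₂ : ℝ) * p.1 / ((d₃ : ℝ) * ((n : ℝ) + 1))} =
    convexHull ℝ
      {((0 : ℝ), (0 : ℝ)),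
       ((((n : ℝ) + 1) * (d₂ : ℝ) - ((n : ℝ) + 3 - (d : ℝ) - (d₁ : ℝ))) / ((n : ℝ) * (d₂ : ℝ)), 0),
       (0, (((n : ℝ) + 1) * (d₃ : ℝ) - ((n : ℝ) + 3 - (d : ℝ) - (d₁ : ℝ))) / ((n : ℝ) * (d₃ : ℝ))),
       (1, ((n : ℝ) + 3 - (d : ℝ) - (d₁ : ℝ) - (d₂ : ℝ)) / (d₃ : ℝ)),
       (((n : ℝ) + 3 - (d : ℝ) - (d₁ : ℝ) - (d₃ : ℝ)) / (d₂ : ℝ), 1)} := by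
  have hn0 : (0 : ℝ) < n := by exact_mod_cast (by lia : 0 < n)
  have hn1 : (2 : ℝ) ≤ n := by exact_mod_cast hn
  have ha : (1 : ℝ) ≤ d₂ := by exact_mod_cast hd₂
  have hb : (1 : ℝ) ≤ d₃ := by exact_mod_cast hd₃
  have hd' : (1 : ℝ) ≤ d := by exact_mod_cast hd
  have hd₁' : (1 : ℝ) ≤ d₁ := by exact_mod_cast hd₁
  have ham : (d₂ : ℝ) + d + d₁ ≤ n + 3 := by exact_mod_cast hd₂'
  have hbm : (d₃ : ℝ) + d + d₁ ≤ n + 3 := by exact_mod_cast hd₃'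
  have hs : (n : ℝ) + 3 ≤ d₂ + d₃ + d + d₁ := by exact_mod_cast hsum
  have ha0 : (0 : ℝ) < d₂ := by linarith
  have hb0 : (0 : ℝ) < d₃ := by linarith
  rw [← pentagon_eq_convexHull hn0 ha0 hb0 (by linarith) (by linarith) (by linarith)
    (by nlinarith) (by nlinarith)]
  ext ⟨x, y⟩
  simp only [Set.mem_ofPred_eq, edge_inequality_iff hn0 ha0, edge_inequality_iff hn0 hb0]
  constructor
  · rintro ⟨hx, -, hy, -, h⟩
    exact ⟨hx, hy, h⟩
  · rintro ⟨hx, hy, hxy, h₁, h₂⟩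
    refine ⟨hx, ?_, hy, ?_, hxy, h₁, h₂⟩
    · have : (n + 1 : ℝ) * (d₂ * x) ≤ (n + 1) * d₂ := by linarith
      exact le_of_mul_le_mul_left (by linarith [le_of_mul_le_mul_left this (by linarith)]) ha0
    · have : (n + 1 : ℝ) * (d₃ * y) ≤ (n + 1) * d₃ := by linarith
      exact le_of_mul_le_mul_left (by linarith [le_of_mul_le_mul_left this (by linarith)]) hb0
end

section
/- Let n be an integer and let d₁, d₂, d₃ be positive integers with d₁ + d₂ + d₃ < n + 1 (so in particular n ≥ 3). Then the polytope T(n,d₁,d₂,d₃) ⊆ ℝ³ equals the convex hull of the eight points (0,0,0), ((n+1)(d₁-1)/(n d₁),0,0), (0,(n+1)(d₂-1)/(n d₂),0), (0,0,(n+1)(d₃-1)/(n d₃)), (0, (d₃-1+n(d₂-1))/((n-1)d₂), (d₂-1+n(d₃-1))/((n-1)d₃)), ((d₃-1+n(d₁-1))/((n-1)d₁), 0, (d₁-1+n(d₃-1))/((n-1)d₃)), ((d₂-1+n(d₁-1))/((n-1)d₁), (d₁-1+n(d₂-1))/((n-1)d₂), 0), and ((d₂+d₃+(n-1)d₁-(n+1))/((n-2)d₁),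 (d₁+d₃+(n-1)d₂-(n+1))/((n-2)d₂), (d₁+d₂+(n-1)d₃-(n+1))/((n-2)d₃)). (This is the combinatorial content of the computation of the K-semistable domain Kss(ℙⁿ, S_{d₁}+S_{d₂}+S_{d₃}) for three general smooth hypersurfaces of degrees d₁, d₂, d₃.) -/
/-- The inequality attached to one divisor, with denominators cleared. -/
lemma divisor_ineq_iff {n d e f : ℝ} (hn : 0 < n + 1) (hd : 0 < d) (x y z : ℝ) :
    0 ≤ (d - 1) / d - n * x / (n + 1) + e * y / (d * (n + 1)) + f * z / (d * (n + 1)) ↔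
      (n + 1) * (d * x) ≤ (n + 1) * (d - 1) + (d * x + e * y + f * z) := by
  have h : (d - 1) / d - n * x / (n + 1) + e * y / (d * (n + 1)) + f * z / (d * (n + 1)) =
      ((n + 1) * (d - 1) + (d * x + e * y + f * z) - (n + 1) * (d * x)) / (d * (n + 1)) := by
    field_simp
    ring
  rw [h, le_div_iff₀ (by positivity), zero_mul, sub_nonneg]

lemma exists_mul_eq_of_nonneg_of_le {u t : ℝ} (hu : 0 ≤ u) (hut : u ≤ t) :
    ∃ l, 0 ≤ l ∧ l ≤ 1 ∧ u = l * t := by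
  rcases (hu.trans hut).eq_or_lt with rfl | ht
  · exact ⟨0, le_rfl, zero_le_one, by linarith⟩
  · exact ⟨u / t, by positivity, (div_le_one ht).2 hut, by field_simp⟩

/-- The polytope `T(n,a,b,c)` described by its six essential inequalities. -/
def reducedPolytope (n a b c : ℝ) : Set (ℝ × ℝ × ℝ) :=
  {p | 0 ≤ p.1 ∧ 0 ≤ p.2.1 ∧ 0 ≤ p.2.2 ∧
    (n + 1) * (a * p.1) ≤ (n + 1) * (a - 1) + (a * p.1 + b * p.2.1 + c * p.2.2) ∧
    (n + 1) * (b * p.2.1) ≤ (n + 1) * (b - 1) + (a * p.1 + b * p.2.1 + c * p.2.2) ∧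
    (n + 1) * (c * p.2.2) ≤ (n + 1) * (c - 1) + (a * p.1 + b * p.2.1 + c * p.2.2)}

lemma convex_reducedPolytope (n a b c : ℝ) : Convex ℝ (reducedPolytope n a b c) := by
  rintro ⟨x, y, z⟩ ⟨hx, hy, hz, h₁, h₂, h₃⟩ ⟨x', y', z'⟩ ⟨hx', hy', hz', h₁', h₂', h₃'⟩
    s t hs ht hst
  simp only at hx hy hz h₁ h₂ h₃ hx' hy' hz' h₁' h₂' h₃'
  obtain rfl : s = 1 - t := by linarith
  simp only [reducedPolytope, Set.mem_ofPred_eq, Prod.smul_mk, Prod.mk_add_mk, smul_eq_mul]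
  refine ⟨by positivity, by positivity, by positivity, ?_, ?_, ?_⟩
  · linarith [mul_le_mul_of_nonneg_left h₁ hs, mul_le_mul_of_nonneg_left h₁' ht]
  · linarith [mul_le_mul_of_nonneg_left h₂ hs, mul_le_mul_of_nonneg_left h₂' ht]
  · linarith [mul_le_mul_of_nonneg_left h₃ hs, mul_le_mul_of_nonneg_left h₃' ht]

/-- On the reduced polytope the remaining inequalities hold automatically. -/
lemma bounds_of_mem_reducedPolytope {n a b c x y z : ℝ} (hn : 3 ≤ n) (ha : 1 ≤ a) (hb : 1 ≤ b)
    (hc : 1 ≤ c) (habc : a + b + c ≤ n + 1) (h : (x, y, z) ∈ reducedPolytope n a b c) :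
    x ≤ 1 ∧ y ≤ 1 ∧ z ≤ 1 ∧ a * x + b * y + c * z ≤ n + 1 := by
  obtain ⟨-, -, -, h₁, h₂, h₃⟩ := h
  simp only at h₁ h₂ h₃
  have hS : a * x + b * y + c * z ≤ n + 1 := by
    by_contra! hS
    nlinarith
  have key : ∀ d t : ℝ, 1 ≤ d →
      (n + 1) * (d * t) ≤ (n + 1) * (d - 1) + (a * x + b * y + c * z) → t ≤ 1 := by
    intro d t hd h
    have h' : (n + 1) * d * t ≤ (n + 1) * d * 1 := by linarith
    exact le_of_mul_le_mul_left h' (by positivity)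
  exact ⟨key a x ha h₁, key b y hb h₂, key c z hc h₃, hS⟩

/-- The eight vertices of the polytope `T(n,a,b,c)`. -/
def polytopeVertices (n a b c : ℝ) : Set (ℝ × ℝ × ℝ) :=
      {(0, 0, 0),
       (((n + 1) * (a - 1)) / (n * a), 0, 0),
       (0, ((n + 1) * (b - 1)) / (n * b), 0),
       (0, 0, ((n + 1) * (c - 1)) / (n * c)),
       (0, (c - 1 + n * (b - 1)) / ((n - 1) * b),
        (b - 1 + n * (c - 1)) / ((n - 1) * c)),
       ((c - 1 + n * (a - 1)) / ((n - 1) * a), 0,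
        (a - 1 + n * (c - 1)) / ((n - 1) * c)),
       ((b - 1 + n * (a - 1)) / ((n - 1) * a),
        (a - 1 + n * (b - 1)) / ((n - 1) * b), 0),
       ((b + c + (n - 1) * a - (n + 1))
          / ((n - 2) * a),
        (a + c + (n - 1) * b - (n + 1))
          / ((n - 2) * b),
        (a + b + (n - 1) * c - (n + 1))
          / ((n - 2) * c))}

lemma polytopeVertices_subset {n a b c : ℝ} (hn : 3 ≤ n) (ha : 1 ≤ a) (hb : 1 ≤ b)
    (hc : 1 ≤ c) : polytopeVertices n a b c ⊆ reducedPolytope n a b c := by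
  obtain ⟨n, rfl⟩ : ∃ m, n = m + 2 := ⟨n - 2, by ring⟩
  obtain ⟨a, rfl⟩ : ∃ m, a = m + 1 := ⟨a - 1, by ring⟩
  obtain ⟨b, rfl⟩ : ∃ m, b = m + 1 := ⟨b - 1, by ring⟩
  obtain ⟨c, rfl⟩ : ∃ m, c = m + 1 := ⟨c - 1, by ring⟩
  replace hn : 0 < n := by linarith
  replace ha : 0 ≤ a := by linarith
  replace hb : 0 ≤ b := by linarith
  replace hc : 0 ≤ c := by linarith
  have e1 : n + 2 - 1 = n + 1 := by ring
  have e2 : n + 2 - 2 = n := by ring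
  have e3 : ∀ a b c : ℝ, b + 1 + (c + 1) + (n + 1) * (a + 1) - (n + 2 + 1) =
    b + c + (n + 1) * a := by intros; ring
  intro p hp
  simp only [polytopeVertices, Set.mem_insert_iff, Set.mem_singleton_iff, e1, e2, e3,
    add_sub_cancel_right] at hp
  rcases hp with rfl | rfl | rfl | rfl | rfl | rfl | rfl | rfl <;>
  simp only [reducedPolytope, Set.mem_ofPred_eq, add_sub_cancel_right, mul_zero, zero_add,
    add_zero] <;>
  refine ⟨by positivity, by positivity, by positivity, ?_, ?_, ?_⟩ <;>
  first
  | positivity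
  | (apply le_of_eq
     field_simp <;> ring)

/-- A point of the reduced polytope is the average of the vertices `v_I`, `I ⊆ {1, 2, 3}`, with
weights proportional to `(n + 1 - |I|) * ∏ i ∈ I, l i * ∏ i ∉ I, (1 - l i)`, where `l i` is
the ratio of the two sides of the `i`-th upper bound. -/
lemma reducedPolytope_subset_convexHull {n a b c : ℝ} (hn : 3 ≤ n) (ha : 1 ≤ a) (hb : 1 ≤ b)
    (hc : 1 ≤ c) : reducedPolytope n a b c ⊆ convexHull ℝ (polytopeVertices n a b c) := by
  rintro ⟨x, y, z⟩ ⟨hx, hy, hz, h₁, h₂, h₃⟩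
  simp only at hx hy hz h₁ h₂ h₃
  obtain ⟨S, hS⟩ : ∃ S, S = (a * x + b * y + c * z) / (n + 1) := ⟨_, rfl⟩
  have hn1 : 0 < n + 1 := by linarith
  have hS' : a * x + b * y + c * z = (n + 1) * S := by rw [hS]; field_simp
  rw [hS', ← mul_add] at h₁ h₂ h₃
  obtain ⟨l, hl0, hl1, hl⟩ := exists_mul_eq_of_nonneg_of_le (by positivity)
    (le_of_mul_le_mul_left h₁ hn1)
  obtain ⟨m, hm0, hm1, hm⟩ := exists_mul_eq_of_nonneg_of_le (by positivity)
    (le_of_mul_le_mul_left h₂ hn1)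
  obtain ⟨k, hk0, hk1, hk⟩ := exists_mul_eq_of_nonneg_of_le (by positivity)
    (le_of_mul_le_mul_left h₃ hn1)
  have hL : 0 < n + 1 - l - m - k := by linarith
  have hn0 : 0 < n := by linarith
  have hn2 : 0 < n - 1 := by linarith
  have hn3 : 0 < n - 2 := by linarith
  have ha0 : 0 < a := by linarith
  have hb0 : 0 < b := by linarith
  have hc0 : 0 < c := by linarith
  have hSval : S = (l * (a - 1) + m * (b - 1) + k * (c - 1)) / (n + 1 - l - m - k) := by
    rw [eq_div_iff hL.ne']
    linarith
  have hxval : x = l * (a - 1 + S) / a := by rw [eq_div_iff ha0.ne']; linarith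
  have hyval : y = m * (b - 1 + S) / b := by rw [eq_div_iff hb0.ne']; linarith
  have hzval : z = k * (c - 1 + S) / c := by rw [eq_div_iff hc0.ne']; linarith
  have hl' : 0 ≤ 1 - l := by linarith
  have hm' : 0 ≤ 1 - m := by linarith
  have hk' : 0 ≤ 1 - k := by linarith
  let v : Fin 8 → ℝ × ℝ × ℝ := ![
      (0, 0, 0),
       (((n + 1) * (a - 1)) / (n * a), 0, 0),
       (0, ((n + 1) * (b - 1)) / (n * b), 0),
       (0, 0, ((n + 1) * (c - 1)) / (n * c)),
       (0, (c - 1 + n * (b - 1)) / ((n - 1) * b),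
        (b - 1 + n * (c - 1)) / ((n - 1) * c)),
       ((c - 1 + n * (a - 1)) / ((n - 1) * a), 0,
        (a - 1 + n * (c - 1)) / ((n - 1) * c)),
       ((b - 1 + n * (a - 1)) / ((n - 1) * a),
        (a - 1 + n * (b - 1)) / ((n - 1) * b), 0),
       ((b + c + (n - 1) * a - (n + 1))
          / ((n - 2) * a),
        (a + c + (n - 1) * b - (n + 1))
          / ((n - 2) * b),
        (a + b + (n - 1) * c - (n + 1))
          / ((n - 2) * c))]
  let w : Fin 8 → ℝ := ![
      (1 - l) * (1 - m) * (1 - k) * (n + 1) / (n + 1 - l - m - k),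
      l * (1 - m) * (1 - k) * n / (n + 1 - l - m - k),
      (1 - l) * m * (1 - k) * n / (n + 1 - l - m - k),
      (1 - l) * (1 - m) * k * n / (n + 1 - l - m - k),
      (1 - l) * m * k * (n - 1) / (n + 1 - l - m - k),
      l * (1 - m) * k * (n - 1) / (n + 1 - l - m - k),
      l * m * (1 - k) * (n - 1) / (n + 1 - l - m - k),
      l * m * k * (n - 2) / (n + 1 - l - m - k)]
  have hw : ∀ i ∈ Finset.univ, 0 ≤ w i := by
    intro i _
    fin_cases i <;> simp only [w] <;> dsimp <;> positivity
  have hw1 : ∑ i, w i = 1 := by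
    simp only [w, Fin.sum_univ_eight]
    dsimp
    field_simp
    ring
  have hv : ∀ i ∈ Finset.univ, v i ∈ convexHull ℝ (polytopeVertices n a b c) := by
    intro i _
    apply subset_convexHull
    fin_cases i <;> simp [v, polytopeVertices]
  have hsum : ∑ i, w i • v i = (x, y, z) := by
    simp only [w, v, Fin.sum_univ_eight]
    rw [hxval, hyval, hzval, hSval]
    dsimp
    refine Prod.ext ?_ (Prod.ext ?_ ?_) <;> dsimp <;> field_simp <;> ring
  exact hsum ▸ (convex_convexHull ℝ _).sum_mem hw hw1 hv


/-- The K-semistable domain `Kss(ℙⁿ, S_{d₁}+S_{d₂}+S_{d₃})` in the case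
`d₁ + d₂ + d₃ < n + 1` (which forces `n ≥ 3`): the polytope `T(n,d₁,d₂,d₃)` equals
the convex hull of eight explicit points. -/
theorem kss_domain_Pn_three_divisors_lt (n d₁ d₂ d₃ : ℕ)
    (hd₁ : 0 < d₁) (hd₂ : 0 < d₂) (hd₃ : 0 < d₃) (hsum : d₁ + d₂ + d₃ < n + 1) :
    {p : ℝ × ℝ × ℝ | 0 ≤ p.1 ∧ p.1 ≤ 1 ∧ 0 ≤ p.2.1 ∧ p.2.1 ≤ 1 ∧ 0 ≤ p.2.2 ∧ p.2.2 ≤ 1 ∧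
      (d₁ : ℝ) * p.1 + (d₂ : ℝ) * p.2.1 + (d₃ : ℝ) * p.2.2 ≤ (n : ℝ) + 1 ∧
      0 ≤ ((d₁ : ℝ) - 1) / (d₁ : ℝ) - (n : ℝ) * p.1 / ((n : ℝ) + 1)
          + (d₂ : ℝ) * p.2.1 / ((d₁ : ℝ) * ((n : ℝ) + 1))
          + (d₃ : ℝ) * p.2.2 / ((d₁ : ℝ) * ((n : ℝ) + 1)) ∧
      0 ≤ ((d₂ : ℝ) - 1) / (d₂ : ℝ) - (n : ℝ) * p.2.1 / ((n : ℝ) + 1)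
          + (d₁ : ℝ) * p.1 / ((d₂ : ℝ) * ((n : ℝ) + 1))
          + (d₃ : ℝ) * p.2.2 / ((d₂ : ℝ) * ((n : ℝ) + 1)) ∧
      0 ≤ ((d₃ : ℝ) - 1) / (d₃ : ℝ) - (n : ℝ) * p.2.2 / ((n : ℝ) + 1)
          + (d₁ : ℝ) * p.1 / ((d₃ : ℝ) * ((n : ℝ) + 1))
          + (d₂ : ℝ) * p.2.1 / ((d₃ : ℝ) * ((n : ℝ) + 1))} =
    convexHull ℝ
      {((0 : ℝ), (0 : ℝ), (0 : ℝ)),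
       ((((n : ℝ) + 1) * ((d₁ : ℝ) - 1)) / ((n : ℝ) * (d₁ : ℝ)), 0, 0),
       (0, (((n : ℝ) + 1) * ((d₂ : ℝ) - 1)) / ((n : ℝ) * (d₂ : ℝ)), 0),
       (0, 0, (((n : ℝ) + 1) * ((d₃ : ℝ) - 1)) / ((n : ℝ) * (d₃ : ℝ))),
       (0, ((d₃ : ℝ) - 1 + (n : ℝ) * ((d₂ : ℝ) - 1)) / (((n : ℝ) - 1) * (d₂ : ℝ)),
        ((d₂ : ℝ) - 1 + (n : ℝ) * ((d₃ : ℝ) - 1)) / (((n : ℝ) - 1) * (d₃ : ℝ))),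
       (((d₃ : ℝ) - 1 + (n : ℝ) * ((d₁ : ℝ) - 1)) / (((n : ℝ) - 1) * (d₁ : ℝ)), 0,
        ((d₁ : ℝ) - 1 + (n : ℝ) * ((d₃ : ℝ) - 1)) / (((n : ℝ) - 1) * (d₃ : ℝ))),
       (((d₂ : ℝ) - 1 + (n : ℝ) * ((d₁ : ℝ) - 1)) / (((n : ℝ) - 1) * (d₁ : ℝ)),
        ((d₁ : ℝ) - 1 + (n : ℝ) * ((d₂ : ℝ) - 1)) / (((n : ℝ) - 1) * (d₂ : ℝ)), 0),
       (((d₂ : ℝ) + (d₃ : ℝ) + ((n : ℝ) - 1) * (d₁ : ℝ) - ((n : ℝ) + 1))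
          / (((n : ℝ) - 2) * (d₁ : ℝ)),
        ((d₁ : ℝ) + (d₃ : ℝ) + ((n : ℝ) - 1) * (d₂ : ℝ) - ((n : ℝ) + 1))
          / (((n : ℝ) - 2) * (d₂ : ℝ)),
        ((d₁ : ℝ) + (d₂ : ℝ) + ((n : ℝ) - 1) * (d₃ : ℝ) - ((n : ℝ) + 1))
          / (((n : ℝ) - 2) * (d₃ : ℝ)))} := by
  have ha : (1 : ℝ) ≤ d₁ := by exact_mod_cast hd₁
  have hb : (1 : ℝ) ≤ d₂ := by exact_mod_cast hd₂
  have hc : (1 : ℝ) ≤ d₃ := by exact_mod_cast hd₃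
  have hn : (3 : ℝ) ≤ n := by exact_mod_cast (by omega : 3 ≤ n)
  have habc : (d₁ : ℝ) + d₂ + d₃ ≤ n + 1 := by exact_mod_cast hsum.le
  have hn1 : (0 : ℝ) < n + 1 := by linarith
  refine Eq.trans (b := reducedPolytope n d₁ d₂ d₃) ?_ <|
    (reducedPolytope_subset_convexHull hn ha hb hc).antisymm <|
      convexHull_min (polytopeVertices_subset hn ha hb hc) (convex_reducedPolytope _ _ _ _)
  ext ⟨x, y, z⟩
  simp only [Set.mem_ofPred_eq, divisor_ineq_iff hn1 (zero_lt_one.trans_le ha),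
    divisor_ineq_iff hn1 (zero_lt_one.trans_le hb), divisor_ineq_iff hn1 (zero_lt_one.trans_le hc)]
  constructor
  · rintro ⟨hx, -, hy, -, hz, -, -, h₁, h₂, h₃⟩
    exact ⟨hx, hy, hz, by linarith, by linarith, by linarith⟩
  · intro h
    obtain ⟨hx', hy', hz', hS⟩ := bounds_of_mem_reducedPolytope hn ha hb hc habc h
    obtain ⟨hx, hy, hz, h₁, h₂, h₃⟩ := h
    simp only at hx hy hz h₁ h₂ h₃
    exact ⟨hx, hx', hy, hy', hz, hz', hS, by linarith, by linarith, by linarith⟩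
end

section
/- Let n be an integer and let d, d₁, d₂, d₃ be positive integers with d₁ + d₂ + d₃ < n + 2 - d (so in particular n ≥ 3). Then the polytope U(n,d,d₁,d₂,d₃) ⊆ ℝ³ equals the convex hull of the eight points (0,0,0), (((n+1)d₁-(n+2-d))/(n d₁),0,0), (0,((n+1)d₂-(n+2-d))/(n d₂),0), (0,0,((n+1)d₃-(n+2-d))/(n d₃)), (0, (d₃+n d₂-(n+2-d))/((n-1)d₂), (d₂+n d₃-(n+2-d))/((n-1)d₃)), ((d₃+n d₁-(n+2-d))/((n-1)d₁), 0, (d₁+n d₃-(n+2-d))/((n-1)d₃)), ((d₂+n d₁-(n+2-d))/((n-1)d₁), (d₁+n d₂-(n+2-d))/((n-1)d₂), 0), and ((d₂+d₃+(n-1)d₁-(n+2-d))/((n-2)d₁), (d₁+d₃+(n-1)d₂-(n+2-d))/((n-2)d₂), (d₁+d₂+(n-1)d₃-(n+2-d))/((n-2)d₃)). (This is the combinatorial content of the computation of the K-semistable domain Kss(S_d, S_{d₁}|_{S_d}+S_{d₂}|_{S_d}+S_{d₃}|_{S_d}) for general smooth hypersurfaces of degrees d, d₁, d₂, d₃ in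 ℙ^{n+1}.) -/
/-- The common value `(r - s) / (n + 1)`, where `s` is the weighted coordinate sum of
`kssPoint n r a b c l m k`. -/
noncomputable def kssSlack (n r a b c l m k : ℝ) : ℝ :=
  (r - (l * a + m * b + k * c)) / (n + 1 - (l + m + k))

/-- Parametrization of the polytope by the unit cube; it sends the vertices of the cube to the
vertices of the polytope and maps each line parallel to an axis to a line. -/
noncomputable def kssPoint (n r a b c l m k : ℝ) : ℝ × ℝ × ℝ :=
  (l * (a - kssSlack n r a b c l m k) / a, m * (b - kssSlack n r a b c l m k) / b,
    k * (c - kssSlack n r a b c l m k) / c)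

/-- The polytope without its redundant constraints and with denominators cleared. -/
def kssPolytope (n r a b c : ℝ) : Set (ℝ × ℝ × ℝ) :=
  {p | 0 ≤ p.1 ∧ 0 ≤ p.2.1 ∧ 0 ≤ p.2.2 ∧
    r - (a * p.1 + b * p.2.1 + c * p.2.2) ≤ (n + 1) * (a - a * p.1) ∧
    r - (a * p.1 + b * p.2.1 + c * p.2.2) ≤ (n + 1) * (b - b * p.2.1) ∧
    r - (a * p.1 + b * p.2.1 + c * p.2.2) ≤ (n + 1) * (c - c * p.2.2)}

theorem convex_kssPolytope (n r a b c : ℝ) : Convex ℝ (kssPolytope n r a b c) := by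
  rintro ⟨x, y, z⟩ ⟨h₁, h₂, h₃, h₄, h₅, h₆⟩ ⟨x', y', z'⟩ ⟨g₁, g₂, g₃, g₄, g₅, g₆⟩ s t hs ht hst
  obtain rfl : t = 1 - s := by linarith
  simp only [kssPolytope, Set.mem_ofPred_eq, Prod.smul_mk, Prod.mk_add_mk, smul_eq_mul] at *
  refine ⟨by positivity, by positivity, by positivity, ?_, ?_, ?_⟩
  · linear_combination s * h₄ + (1 - s) * g₄
  · linear_combination s * h₅ + (1 - s) * g₅
  · linear_combination s * h₆ + (1 - s) * g₆

theorem kssSlack_le_one {n r a b c l m k : ℝ} (hn : 3 ≤ n) (ha : 1 ≤ a) (hb : 1 ≤ b)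
    (hc : 1 ≤ c) (hr : r ≤ n + 1) (hl : l ∈ Set.Icc (0 : ℝ) 1) (hm : m ∈ Set.Icc (0 : ℝ) 1)
    (hk : k ∈ Set.Icc (0 : ℝ) 1) : kssSlack n r a b c l m k ≤ 1 := by
  obtain ⟨hl₀, hl₁⟩ := hl
  obtain ⟨hm₀, hm₁⟩ := hm
  obtain ⟨hk₀, hk₁⟩ := hk
  rw [kssSlack, div_le_one (by linarith)]
  nlinarith

theorem kssPoint_mem_kssPolytope {n r a b c l m k : ℝ} (hn : 3 ≤ n) (ha : 1 ≤ a) (hb : 1 ≤ b)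
    (hc : 1 ≤ c) (hr : r ≤ n + 1) (hl : l ∈ Set.Icc (0 : ℝ) 1) (hm : m ∈ Set.Icc (0 : ℝ) 1)
    (hk : k ∈ Set.Icc (0 : ℝ) 1) : kssPoint n r a b c l m k ∈ kssPolytope n r a b c := by
  have ht := kssSlack_le_one hn ha hb hc hr hl hm hk
  have hden : n + 1 - (l + m + k) ≠ 0 := by linarith [hl.2, hm.2, hk.2]
  have hs : kssSlack n r a b c l m k * (n + 1 - (l + m + k)) = r - (l * a + m * b + k * c) :=
    div_mul_cancel₀ _ hden
  simp only [kssPoint, kssPolytope, Set.mem_ofPred_eq]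
  set t := kssSlack n r a b c l m k
  obtain ⟨hl₀, hl₁⟩ := hl
  obtain ⟨hm₀, hm₁⟩ := hm
  obtain ⟨hk₀, hk₁⟩ := hk
  have hn' : 0 ≤ n + 1 := by linarith
  have ha' : 0 ≤ a - t := by linarith
  have hb' : 0 ≤ b - t := by linarith
  have hc' : 0 ≤ c - t := by linarith
  rw [mul_div_cancel₀ _ (by positivity : a ≠ 0), mul_div_cancel₀ _ (by positivity : b ≠ 0),
    mul_div_cancel₀ _ (by positivity : c ≠ 0)]
  refine ⟨by positivity, by positivity, by positivity, ?_, ?_, ?_⟩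
  · linear_combination mul_nonneg hn' (mul_nonneg (sub_nonneg.2 hl₁) ha') - hs
  · linear_combination mul_nonneg hn' (mul_nonneg (sub_nonneg.2 hm₁) hb') - hs
  · linear_combination mul_nonneg hn' (mul_nonneg (sub_nonneg.2 hk₁) hc') - hs

theorem exists_mem_Icc_mul_eq {u v : ℝ} (hu : 0 ≤ u) (huv : u ≤ v) :
    ∃ l ∈ Set.Icc (0 : ℝ) 1, l * v = u := by
  rcases (hu.trans huv).eq_or_lt with rfl | hv
  · exact ⟨0, by simp, by linarith⟩
  · exact ⟨u / v, ⟨by positivity, (div_le_one hv).2 huv⟩, div_mul_cancel₀ _ hv.ne'⟩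

theorem exists_kssPoint_eq {n r a b c : ℝ} (hn : 3 ≤ n) (ha : 1 ≤ a) (hb : 1 ≤ b) (hc : 1 ≤ c)
    {p : ℝ × ℝ × ℝ} (hp : p ∈ kssPolytope n r a b c) :
    ∃ l ∈ Set.Icc (0 : ℝ) 1, ∃ m ∈ Set.Icc (0 : ℝ) 1, ∃ k ∈ Set.Icc (0 : ℝ) 1,
      kssPoint n r a b c l m k = p := by
  obtain ⟨x, y, z⟩ := p
  obtain ⟨hx, hy, hz, h₁, h₂, h₃⟩ := hp
  dsimp only at hx hy hz h₁ h₂ h₃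
  have hn' : 0 < n + 1 := by linarith
  obtain ⟨t, ht⟩ : ∃ t, (n + 1) * t = r - (a * x + b * y + c * z) :=
    ⟨_, mul_div_cancel₀ _ hn'.ne'⟩
  rw [← ht] at h₁ h₂ h₃
  have h₁ := le_of_mul_le_mul_left h₁ hn'
  have h₂ := le_of_mul_le_mul_left h₂ hn'
  have h₃ := le_of_mul_le_mul_left h₃ hn'
  obtain ⟨l, hl, hlx⟩ := exists_mem_Icc_mul_eq (u := a * x) (v := a - t) (by positivity)
    (by linarith)
  obtain ⟨m, hm, hmy⟩ := exists_mem_Icc_mul_eq (u := b * y) (v := b - t) (by positivity)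
    (by linarith)
  obtain ⟨k, hk, hkz⟩ := exists_mem_Icc_mul_eq (u := c * z) (v := c - t) (by positivity)
    (by linarith)
  have hden : n + 1 - (l + m + k) ≠ 0 := by linarith [hl.2, hm.2, hk.2]
  have hs : kssSlack n r a b c l m k = t := by
    rw [kssSlack, div_eq_iff hden]
    linear_combination -hlx - hmy - hkz - ht
  refine ⟨l, hl, m, hm, k, hk, ?_⟩
  rw [kssPoint, hs, hlx, hmy, hkz, mul_div_cancel_left₀ _ (by positivity),
    mul_div_cancel_left₀ _ (by positivity), mul_div_cancel_left₀ _ (by positivity)]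

theorem kssPoint_mem_segment_fst {n r a b c l m k : ℝ} (hn : 3 ≤ n) (ha : a ≠ 0) (hb : b ≠ 0)
    (hc : c ≠ 0) (hl : l ∈ Set.Icc (0 : ℝ) 1) (hm : m ∈ Set.Icc (0 : ℝ) 1)
    (hk : k ∈ Set.Icc (0 : ℝ) 1) :
    kssPoint n r a b c l m k ∈ segment ℝ (kssPoint n r a b c 0 m k) (kssPoint n r a b c 1 m k) := by
  obtain ⟨hl₀, hl₁⟩ := hl
  obtain ⟨hm₀, hm₁⟩ := hm
  obtain ⟨hk₀, hk₁⟩ := hk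
  have h : 0 < n + 1 - (l + m + k) := by linarith
  have h₀ : 0 < n + 1 - (0 + m + k) := by linarith
  have h₁ : 0 < n + 1 - (1 + m + k) := by linarith
  refine ⟨(1 - l) * (n + 1 - (0 + m + k)) / (n + 1 - (l + m + k)),
    l * (n + 1 - (1 + m + k)) / (n + 1 - (l + m + k)),
    div_nonneg (mul_nonneg (by linarith) h₀.le) h.le, div_nonneg (mul_nonneg hl₀ h₁.le) h.le,
    by field_simp; ring, ?_⟩
  simp only [kssPoint, kssSlack, Prod.smul_mk, Prod.mk_add_mk, smul_eq_mul, Prod.mk.injEq]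
  have := h.ne'
  have := h₀.ne'
  have := h₁.ne'
  refine ⟨?_, ?_, ?_⟩ <;> field_simp <;> ring

theorem kssPoint_mem_segment_snd {n r a b c l m k : ℝ} (hn : 3 ≤ n) (ha : a ≠ 0) (hb : b ≠ 0)
    (hc : c ≠ 0) (hl : l ∈ Set.Icc (0 : ℝ) 1) (hm : m ∈ Set.Icc (0 : ℝ) 1)
    (hk : k ∈ Set.Icc (0 : ℝ) 1) :
    kssPoint n r a b c l m k ∈ segment ℝ (kssPoint n r a b c l 0 k) (kssPoint n r a b c l 1 k) := by
  obtain ⟨hl₀, hl₁⟩ := hl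
  obtain ⟨hm₀, hm₁⟩ := hm
  obtain ⟨hk₀, hk₁⟩ := hk
  have h : 0 < n + 1 - (l + m + k) := by linarith
  have h₀ : 0 < n + 1 - (l + 0 + k) := by linarith
  have h₁ : 0 < n + 1 - (l + 1 + k) := by linarith
  refine ⟨(1 - m) * (n + 1 - (l + 0 + k)) / (n + 1 - (l + m + k)),
    m * (n + 1 - (l + 1 + k)) / (n + 1 - (l + m + k)),
    div_nonneg (mul_nonneg (by linarith) h₀.le) h.le, div_nonneg (mul_nonneg hm₀ h₁.le) h.le,
    by field_simp; ring, ?_⟩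
  simp only [kssPoint, kssSlack, Prod.smul_mk, Prod.mk_add_mk, smul_eq_mul, Prod.mk.injEq]
  have := h.ne'
  have := h₀.ne'
  have := h₁.ne'
  refine ⟨?_, ?_, ?_⟩ <;> field_simp <;> ring

theorem kssPoint_mem_segment_thd {n r a b c l m k : ℝ} (hn : 3 ≤ n) (ha : a ≠ 0) (hb : b ≠ 0)
    (hc : c ≠ 0) (hl : l ∈ Set.Icc (0 : ℝ) 1) (hm : m ∈ Set.Icc (0 : ℝ) 1)
    (hk : k ∈ Set.Icc (0 : ℝ) 1) :
    kssPoint n r a b c l m k ∈ segment ℝ (kssPoint n r a b c l m 0) (kssPoint n r a b c l m 1) := by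
  obtain ⟨hl₀, hl₁⟩ := hl
  obtain ⟨hm₀, hm₁⟩ := hm
  obtain ⟨hk₀, hk₁⟩ := hk
  have h : 0 < n + 1 - (l + m + k) := by linarith
  have h₀ : 0 < n + 1 - (l + m + 0) := by linarith
  have h₁ : 0 < n + 1 - (l + m + 1) := by linarith
  refine ⟨(1 - k) * (n + 1 - (l + m + 0)) / (n + 1 - (l + m + k)),
    k * (n + 1 - (l + m + 1)) / (n + 1 - (l + m + k)),
    div_nonneg (mul_nonneg (by linarith) h₀.le) h.le, div_nonneg (mul_nonneg hk₀ h₁.le) h.le,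
    by field_simp; ring, ?_⟩
  simp only [kssPoint, kssSlack, Prod.smul_mk, Prod.mk_add_mk, smul_eq_mul, Prod.mk.injEq]
  have := h.ne'
  have := h₀.ne'
  have := h₁.ne'
  refine ⟨?_, ?_, ?_⟩ <;> field_simp <;> ring

theorem kssPolytope_eq_convexHull {n r a b c : ℝ} (hn : 3 ≤ n) (ha : 1 ≤ a) (hb : 1 ≤ b)
    (hc : 1 ≤ c) (hr : r ≤ n + 1) :
    kssPolytope n r a b c = convexHull ℝ
      {kssPoint n r a b c 0 0 0, kssPoint n r a b c 1 0 0, kssPoint n r a b c 0 1 0,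
        kssPoint n r a b c 0 0 1, kssPoint n r a b c 0 1 1, kssPoint n r a b c 1 0 1,
        kssPoint n r a b c 1 1 0, kssPoint n r a b c 1 1 1} := by
  have h₀ : (0 : ℝ) ∈ Set.Icc (0 : ℝ) 1 := by simp
  have h₁ : (1 : ℝ) ∈ Set.Icc (0 : ℝ) 1 := by simp
  have ha₀ : a ≠ 0 := by positivity
  have hb₀ : b ≠ 0 := by positivity
  have hc₀ : c ≠ 0 := by positivity
  apply Set.Subset.antisymm
  · intro p hp
    obtain ⟨l, hl, m, hm, k, hk, rfl⟩ := exists_kssPoint_eq hn ha hb hc hp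
    have hconv := convex_convexHull ℝ
      {kssPoint n r a b c 0 0 0, kssPoint n r a b c 1 0 0, kssPoint n r a b c 0 1 0,
        kssPoint n r a b c 0 0 1, kssPoint n r a b c 0 1 1, kssPoint n r a b c 1 0 1,
        kssPoint n r a b c 1 1 0, kssPoint n r a b c 1 1 1}
    refine hconv.segment_subset ?_ ?_ (kssPoint_mem_segment_fst hn ha₀ hb₀ hc₀ hl hm hk)
    · refine hconv.segment_subset ?_ ?_ (kssPoint_mem_segment_snd hn ha₀ hb₀ hc₀ h₀ hm hk)
      · refine hconv.segment_subset ?_ ?_ (kssPoint_mem_segment_thd hn ha₀ hb₀ hc₀ h₀ h₀ hk) <;>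
          exact subset_convexHull _ _ (by simp)
      · refine hconv.segment_subset ?_ ?_ (kssPoint_mem_segment_thd hn ha₀ hb₀ hc₀ h₀ h₁ hk) <;>
          exact subset_convexHull _ _ (by simp)
    · refine hconv.segment_subset ?_ ?_ (kssPoint_mem_segment_snd hn ha₀ hb₀ hc₀ h₁ hm hk)
      · refine hconv.segment_subset ?_ ?_ (kssPoint_mem_segment_thd hn ha₀ hb₀ hc₀ h₁ h₀ hk) <;>
          exact subset_convexHull _ _ (by simp)
      · refine hconv.segment_subset ?_ ?_ (kssPoint_mem_segment_thd hn ha₀ hb₀ hc₀ h₁ h₁ hk) <;>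
          exact subset_convexHull _ _ (by simp)
  · refine convexHull_min ?_ (convex_kssPolytope n r a b c)
    simp only [Set.insert_subset_iff, Set.singleton_subset_iff]
    refine ⟨?_, ?_, ?_, ?_, ?_, ?_, ?_, ?_⟩ <;>
      apply kssPoint_mem_kssPolytope hn ha hb hc hr <;> assumption

theorem kssConstraint_nonneg_iff {n r a x u v : ℝ} (hn : 0 < n + 1) (ha : 0 < a) :
    0 ≤ (a * (n + 1) - r) / (a * (n + 1)) - n * x / (n + 1) + u / (a * (n + 1))
        + v / (a * (n + 1)) ↔ r - (a * x + u + v) ≤ (n + 1) * (a - a * x) := by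
  have h : (a * (n + 1) - r) / (a * (n + 1)) - n * x / (n + 1) + u / (a * (n + 1))
      + v / (a * (n + 1)) = ((n + 1) * (a - a * x) - (r - (a * x + u + v))) / (a * (n + 1)) := by
    field_simp
    ring
  rw [h, le_div_iff₀ (by positivity), zero_mul, sub_nonneg]

theorem mem_kssPolytope_iff {n r a b c : ℝ} (hn : 3 ≤ n) (ha : 1 ≤ a) (hb : 1 ≤ b) (hc : 1 ≤ c)
    (hr : a + b + c < r) (p : ℝ × ℝ × ℝ) :
    p ∈ kssPolytope n r a b c ↔
      0 ≤ p.1 ∧ p.1 ≤ 1 ∧ 0 ≤ p.2.1 ∧ p.2.1 ≤ 1 ∧ 0 ≤ p.2.2 ∧ p.2.2 ≤ 1 ∧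
      a * p.1 + b * p.2.1 + c * p.2.2 ≤ r ∧
      r - (a * p.1 + b * p.2.1 + c * p.2.2) ≤ (n + 1) * (a - a * p.1) ∧
      r - (a * p.1 + b * p.2.1 + c * p.2.2) ≤ (n + 1) * (b - b * p.2.1) ∧
      r - (a * p.1 + b * p.2.1 + c * p.2.2) ≤ (n + 1) * (c - c * p.2.2) := by
  refine ⟨?_, fun ⟨h₁, _, h₂, _, h₃, _, _, h₄, h₅, h₆⟩ => ⟨h₁, h₂, h₃, h₄, h₅, h₆⟩⟩
  rintro ⟨hx, hy, hz, h₁, h₂, h₃⟩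
  obtain ⟨x, y, z⟩ := p
  dsimp only at *
  have hs : a * x + b * y + c * z ≤ r := by
    have : 0 ≤ (n - 2) * (a + b + c - (a * x + b * y + c * z)) := by linarith
    linarith [nonneg_of_mul_nonneg_right this (by linarith)]
  have le_one {e w : ℝ} (he : 1 ≤ e)
      (h : r - (a * x + b * y + c * z) ≤ (n + 1) * (e - e * w)) : w ≤ 1 := by
    have : 0 ≤ (n + 1) * e * (1 - w) := by linarith
    linarith [nonneg_of_mul_nonneg_right this (by positivity)]
  exact ⟨hx, le_one ha h₁, hy, le_one hb h₂, hz, le_one hc h₃, hs, h₁, h₂, h₃⟩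


/-- The K-semistable domain `Kss(S_d, S_{d₁}|_{S_d}+S_{d₂}|_{S_d}+S_{d₃}|_{S_d})` in the
case `d₁ + d₂ + d₃ < n + 2 - d` (which forces `n ≥ 3`): the polytope `U(n,d,d₁,d₂,d₃)`
equals the convex hull of eight explicit points. -/
theorem kss_domain_Sd_three_divisors_lt (n d d₁ d₂ d₃ : ℕ)
    (hd : 0 < d) (hd₁ : 0 < d₁) (hd₂ : 0 < d₂) (hd₃ : 0 < d₃)
    (hsum : d₁ + d₂ + d₃ + d < n + 2) :
    {p : ℝ × ℝ × ℝ | 0 ≤ p.1 ∧ p.1 ≤ 1 ∧ 0 ≤ p.2.1 ∧ p.2.1 ≤ 1 ∧ 0 ≤ p.2.2 ∧ p.2.2 ≤ 1 ∧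
      (d₁ : ℝ) * p.1 + (d₂ : ℝ) * p.2.1 + (d₃ : ℝ) * p.2.2 ≤ (n : ℝ) + 2 - (d : ℝ) ∧
      0 ≤ ((d₁ : ℝ) * ((n : ℝ) + 1) - ((n : ℝ) + 2 - (d : ℝ))) / ((d₁ : ℝ) * ((n : ℝ) + 1))
          - (n : ℝ) * p.1 / ((n : ℝ) + 1)
          + (d₂ : ℝ) * p.2.1 / ((d₁ : ℝ) * ((n : ℝ) + 1))
          + (d₃ : ℝ) * p.2.2 / ((d₁ : ℝ) * ((n : ℝ) + 1)) ∧
      0 ≤ ((d₂ : ℝ) * ((n : ℝ) + 1) - ((n : ℝ) + 2 - (d : ℝ))) / ((d₂ : ℝ) * ((n : ℝ) + 1))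
          - (n : ℝ) * p.2.1 / ((n : ℝ) + 1)
          + (d₁ : ℝ) * p.1 / ((d₂ : ℝ) * ((n : ℝ) + 1))
          + (d₃ : ℝ) * p.2.2 / ((d₂ : ℝ) * ((n : ℝ) + 1)) ∧
      0 ≤ ((d₃ : ℝ) * ((n : ℝ) + 1) - ((n : ℝ) + 2 - (d : ℝ))) / ((d₃ : ℝ) * ((n : ℝ) + 1))
          - (n : ℝ) * p.2.2 / ((n : ℝ) + 1)
          + (d₁ : ℝ) * p.1 / ((d₃ : ℝ) * ((n : ℝ) + 1))
          + (d₂ : ℝ) * p.2.1 / ((d₃ : ℝ) * ((n : ℝ) + 1))} =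
    convexHull ℝ
      {((0 : ℝ), (0 : ℝ), (0 : ℝ)),
       ((((n : ℝ) + 1) * (d₁ : ℝ) - ((n : ℝ) + 2 - (d : ℝ))) / ((n : ℝ) * (d₁ : ℝ)), 0, 0),
       (0, (((n : ℝ) + 1) * (d₂ : ℝ) - ((n : ℝ) + 2 - (d : ℝ))) / ((n : ℝ) * (d₂ : ℝ)), 0),
       (0, 0, (((n : ℝ) + 1) * (d₃ : ℝ) - ((n : ℝ) + 2 - (d : ℝ))) / ((n : ℝ) * (d₃ : ℝ))),
       (0, ((d₃ : ℝ) + (n : ℝ) * (d₂ : ℝ) - ((n : ℝ) + 2 - (d : ℝ))) / (((n : ℝ) - 1) * (d₂ : ℝ)),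
        ((d₂ : ℝ) + (n : ℝ) * (d₃ : ℝ) - ((n : ℝ) + 2 - (d : ℝ))) / (((n : ℝ) - 1) * (d₃ : ℝ))),
       (((d₃ : ℝ) + (n : ℝ) * (d₁ : ℝ) - ((n : ℝ) + 2 - (d : ℝ))) / (((n : ℝ) - 1) * (d₁ : ℝ)), 0,
        ((d₁ : ℝ) + (n : ℝ) * (d₃ : ℝ) - ((n : ℝ) + 2 - (d : ℝ))) / (((n : ℝ) - 1) * (d₃ : ℝ))),
       (((d₂ : ℝ) + (n : ℝ) * (d₁ : ℝ) - ((n : ℝ) + 2 - (d : ℝ))) / (((n : ℝ) - 1) * (d₁ : ℝ)),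
        ((d₁ : ℝ) + (n : ℝ) * (d₂ : ℝ) - ((n : ℝ) + 2 - (d : ℝ))) / (((n : ℝ) - 1) * (d₂ : ℝ)), 0),
       (((d₂ : ℝ) + (d₃ : ℝ) + ((n : ℝ) - 1) * (d₁ : ℝ) - ((n : ℝ) + 2 - (d : ℝ)))
          / (((n : ℝ) - 2) * (d₁ : ℝ)),
        ((d₁ : ℝ) + (d₃ : ℝ) + ((n : ℝ) - 1) * (d₂ : ℝ) - ((n : ℝ) + 2 - (d : ℝ)))
          / (((n : ℝ) - 2) * (d₂ : ℝ)),
        ((d₁ : ℝ) + (d₂ : ℝ) + ((n : ℝ) - 1) * (d₃ : ℝ) - ((n : ℝ) + 2 - (d : ℝ)))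
          / (((n : ℝ) - 2) * (d₃ : ℝ)))} := by
  have hn : (3 : ℝ) ≤ n := by exact_mod_cast (by omega : 3 ≤ n)
  have ha : (1 : ℝ) ≤ d₁ := by exact_mod_cast hd₁
  have hb : (1 : ℝ) ≤ d₂ := by exact_mod_cast hd₂
  have hc : (1 : ℝ) ≤ d₃ := by exact_mod_cast hd₃
  have hd' : (1 : ℝ) ≤ d := by exact_mod_cast hd
  have hsum' : (d₁ : ℝ) + d₂ + d₃ + d < n + 2 := by exact_mod_cast hsum
  generalize (n : ℝ) = n at *
  generalize (d₁ : ℝ) = a at *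
  generalize (d₂ : ℝ) = b at *
  generalize (d₃ : ℝ) = c at *
  obtain ⟨r, hr⟩ : ∃ r, r = n + 2 - (d : ℝ) := ⟨_, rfl⟩
  simp only [← hr]
  have hpoly := kssPolytope_eq_convexHull hn ha hb hc (r := r) (by linarith)
  have hn₀ : n ≠ 0 := by positivity
  have hn₁ : n - 1 ≠ 0 := by linarith
  have hn₂ : n - 2 ≠ 0 := by linarith
  have e₁ : n + 1 - 1 = n := by ring
  have e₂ : n + 1 - (1 + 1) = n - 1 := by ring
  have e₃ : n + 1 - (1 + 1 + 1) = n - 2 := by ring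
  have ha₀ : a ≠ 0 := by positivity
  have hb₀ : b ≠ 0 := by positivity
  have hc₀ : c ≠ 0 := by positivity
  convert hpoly using 1
  · ext p
    rw [mem_kssPolytope_iff hn ha hb hc (by linarith), Set.mem_ofPred_eq,
      kssConstraint_nonneg_iff (by positivity) (by positivity),
      kssConstraint_nonneg_iff (by positivity) (by positivity),
      kssConstraint_nonneg_iff (by positivity) (by positivity),
      show b * p.2.1 + a * p.1 + c * p.2.2 = a * p.1 + b * p.2.1 + c * p.2.2 by ring,
      show c * p.2.2 + a * p.1 + b * p.2.1 = a * p.1 + b * p.2.1 + c * p.2.2 by ring]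
  · simp only [kssPoint, kssSlack, zero_mul, one_mul, add_zero, zero_add, zero_div, e₁, e₂, e₃]
    refine congrArg (convexHull ℝ) (congrArg₂ insert rfl (congrArg₂ insert ?_
      (congrArg₂ insert ?_ (congrArg₂ insert ?_ (congrArg₂ insert ?_ (congrArg₂ insert ?_
        (congrArg₂ insert ?_ (congrArg singleton ?_))))))))
    all_goals
      rw [Prod.mk.injEq, Prod.mk.injEq]
      refine ⟨?_, ?_, ?_⟩ <;> first | rfl | (field_simp; ring)
end
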